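/- For the 4-uple Veronese embedding of ℙ² (d = 4, b = 0): dim K_{0,0}(ℙ²,0;4) = 1; dim K_{p,1}(ℙ²,0;4) for p = 1,…,10 equals 75, 536, 1947, 4488, 7095, 7920, 6237, 3344, 1089, 120 respectively; dim K_{p,2}(ℙ²,0;4) for p = 10, 11, 12 equals 55, 24, 3 respectively; and K_{p,q}(ℙ²,0;4) = 0 for all other pairs (p,q) with p ≥ 0 and q ∈ ℤ. -/

import Mathlib

open scoped TensorProduct

set_option maxHeartbeats 2000000
set_option synthInstance.maxHeartbeats 1000000

noncomputable section

/-- The dimension (over `ℂ`) of a complex vector space, as a natural number. -/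
def cdim (M : Type*) [AddCommMonoid M] [Module ℂ M] : ℕ := (Module.rank ℂ M).toNat

/-- The polynomial ring `S = ℂ[x₀,…,x_{N-1}]`. -/
abbrev PolyC (N : ℕ) : Type := MvPolynomial (Fin N) ℂ

/-- The space `S_e` of homogeneous polynomials of degree `e` (zero for `e < 0`). -/
def Sdeg (N : ℕ) (e : ℤ) : Submodule ℂ (PolyC N) :=
  if 0 ≤ e then MvPolynomial.homogeneousSubmodule (Fin N) ℂ e.toNat else ⊥

/-- The monomial `x^σ`. -/
def monoC (N : ℕ) (σ : Fin N →₀ ℕ) : PolyC N := MvPolynomial.monomial σ (1 : ℂ)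

/-- The wedge product `m₁ ∧ ⋯ ∧ mₙ` as an element of the `n`-th exterior power. -/
def wedgeE (R : Type*) [CommRing R] (M : Type*) [AddCommGroup M] [Module R M]
    (n : ℕ) (m : Fin n → M) : ↥(⋀[R]^n M) :=
  ⟨ExteriorAlgebra.ιMulti R n m, ExteriorAlgebra.ιMulti_range R n ⟨m, rfl⟩⟩

/-- The module `⋀^p S_d ⊗ S_e`. -/
abbrev KosModule (N : ℕ) (d : ℤ) (p : ℕ) (e : ℤ) : Type :=
  (↥(⋀[ℂ]^p ↥(Sdeg N d))) ⊗[ℂ] ↥(Sdeg N e)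

/-- `D` satisfies the defining formula of the Koszul differential
`∂_{p+1} : ⋀^{p+1} S_d ⊗ S_e → ⋀^p S_d ⊗ S_{e'}` (for `e' = e + d`), namely
`∂(m₁∧⋯∧m_{p+1} ⊗ f) = ∑ₖ (−1)ᵏ m₁∧⋯∧m̂ₖ∧⋯∧m_{p+1} ⊗ (mₖ·f)`; the equality is
stated after applying the (injective) inclusion `⋀^p S_d ⊗ S_{e'} → ⋀^p S_d ⊗ S`. -/
def IsKoszulDiff (N : ℕ) (d e e' : ℤ) (p : ℕ)
    (D : KosModule N d (p + 1) e →ₗ[ℂ] KosModule N d p e') : Prop :=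
  ∀ (m : Fin (p + 1) → ↥(Sdeg N d)) (f : ↥(Sdeg N e)),
    TensorProduct.map (LinearMap.id (R := ℂ) (M := ↥(⋀[ℂ]^p ↥(Sdeg N d)))) (Sdeg N e').subtype
        (D (wedgeE ℂ ↥(Sdeg N d) (p + 1) m ⊗ₜ[ℂ] f)) =
      ∑ k : Fin (p + 1), ((-1 : ℂ) ^ ((k : ℕ) + 1)) •
        (wedgeE ℂ ↥(Sdeg N d) p (fun i => m (Fin.succAbove k i)) ⊗ₜ[ℂ]
          ((m k : PolyC N) * (f : PolyC N)))

/-- A family of maps of the shape of the Koszul differentials. -/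
def KFam (N : ℕ) (d : ℤ) : Type :=
  ∀ (p : ℕ) (e e' : ℤ), KosModule N d (p + 1) e →ₗ[ℂ] KosModule N d p e'

/-- The family `D` consists of the Koszul differentials (at all meaningful degrees). -/
def IsKoszulFam (N : ℕ) (d : ℤ) (D : KFam N d) : Prop :=
  ∀ (p : ℕ) (e e' : ℤ), e' = e + d → IsKoszulDiff N d e e' p (D p e e')

/-- `dim K_{p,q}(ℙ^{N-1}, b; d)`: the dimension of the homology `ker ∂_p / im ∂_{p+1}` at the
middle term of `⋀^{p+1} S_d ⊗ S_{b+(q-1)d} → ⋀^p S_d ⊗ S_{b+qd} → ⋀^{p-1} S_d ⊗ S_{b+(q+1)d}`,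
where for `p = 0` the right-hand map is the zero map (the dimension of the quotient is expressed
as `dim ker − dim (im ⊓ ker)`, which agrees with it since all spaces here are
finite-dimensional). -/
def Kdim (N : ℕ) (d : ℤ) (D : KFam N d) (b : ℤ) : ℕ → ℤ → ℕ
  | 0, q =>
      cdim (KosModule N d 0 (b + q * d)) -
        cdim ↥(LinearMap.range (D 0 (b + (q - 1) * d) (b + q * d)))
  | p + 1, q =>
      cdim ↥(LinearMap.ker (D p (b + q * d) (b + (q + 1) * d))) -
        cdim
          ↥(LinearMap.range (D (p + 1) (b + (q - 1) * d) (b + q * d)) ⊓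
            LinearMap.ker (D p (b + q * d) (b + (q + 1) * d)))

/-- The multidegree-`a` component of `⋀^p S_d ⊗ S_e`: the span of the pure tensors
`m₁∧⋯∧m_p ⊗ f` with the `mᵢ` and `f` monomials of total multidegree `a`. -/
def KComp (N : ℕ) (d : ℤ) (p : ℕ) (e : ℤ) (a : Fin N →₀ ℕ) :
    Submodule ℂ (KosModule N d p e) :=
  Submodule.span ℂ
    { x | ∃ (σ : Fin p → (Fin N →₀ ℕ)) (τ : Fin N →₀ ℕ)
        (hσ : ∀ i, monoC N (σ i) ∈ Sdeg N d) (hτ : monoC N τ ∈ Sdeg N e),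
        (∑ i, σ i) + τ = a ∧
        x = wedgeE ℂ ↥(Sdeg N d) p (fun i => (⟨monoC N (σ i), hσ i⟩ : ↥(Sdeg N d))) ⊗ₜ[ℂ]
            (⟨monoC N τ, hτ⟩ : ↥(Sdeg N e)) }

/-- `dim K_{p,q}(ℙ^{N-1}, b; d)_a`: the dimension of the multidegree-`a` component of the
homology, i.e. of `(ker ∂_p ∩ (⋀^p S_d ⊗ S_{b+qd})_a) / (im ∂_{p+1} ∩ (⋀^p S_d ⊗ S_{b+qd})_a)`
(again expressed as a difference of dimensions). -/
def KdimA (N : ℕ) (d : ℤ) (D : KFam N d) (b : ℤ) : ℕ → ℤ → (Fin N →₀ ℕ) → ℕ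
  | 0, q, a =>
      cdim ↥(KComp N d 0 (b + q * d) a) -
        cdim
          ↥(LinearMap.range (D 0 (b + (q - 1) * d) (b + q * d)) ⊓ KComp N d 0 (b + q * d) a)
  | p + 1, q, a =>
      cdim
        ↥(LinearMap.ker (D p (b + q * d) (b + (q + 1) * d)) ⊓ KComp N d (p + 1) (b + q * d) a) -
        cdim
          ↥(LinearMap.range (D (p + 1) (b + (q - 1) * d) (b + q * d)) ⊓
            (LinearMap.ker (D p (b + q * d) (b + (q + 1) * d)) ⊓
              KComp N d (p + 1) (b + q * d) a))

/-- Build a multidegree in `Fin 3 →₀ ℕ` from three exponents. -/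
def mdeg3 (i j k : ℕ) : Fin 3 →₀ ℕ := Finsupp.equivFunOnFinite.symm ![i, j, k]

end

set_option maxHeartbeats 400000

namespace VB

/-- exponent vectors of the 15 quartic monomials; the pure powers come last -/
def ev : Fin 15 → Fin 3 → ℕ :=
  ![![3,1,0], ![3,0,1], ![2,2,0], ![2,1,1], ![2,0,2], ![1,3,0], ![1,2,1], ![1,1,2], ![1,0,3],
    ![0,3,1], ![0,2,2], ![0,1,3], ![0,0,4], ![0,4,0], ![4,0,0]]

instance decLe3 (a b : Fin 3 → ℕ) : Decidable (a ≤ b) :=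
  inferInstanceAs (Decidable (∀ i, a i ≤ b i))

/-- coordinates of total Koszul chains -/
abbrev F : Type := Finset (Fin 15) → (Fin 3 → ℕ) → ℂ

/-- Koszul sign -/
noncomputable def sg (i : Fin 15) (T : Finset (Fin 15)) : ℂ := (-1) ^ (T.filter (· < i)).card

lemma sg_ne (i T) : sg i T ≠ 0 := by unfold sg; simp

lemma sg_sq (i T) : sg i T * sg i T = 1 := by
  unfold sg; rw [← mul_pow]; simp

lemma sg_insert_lt {i j : Fin 15} {T : Finset (Fin 15)} (hi : i ∉ T) (h : i < j) :
    sg j (insert i T) = - sg j T := by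
  unfold sg
  rw [Finset.filter_insert, if_pos h, Finset.card_insert_of_notMem (by simp [hi]), pow_succ]
  ring

lemma sg_insert_gt {i j : Fin 15} {T : Finset (Fin 15)} (h : j < i) :
    sg j (insert i T) = sg j T := by
  unfold sg
  rw [Finset.filter_insert, if_neg (by simpa using h.le)]

lemma sg_anti {i j : Fin 15} {T : Finset (Fin 15)} (hi : i ∉ T) (hj : j ∉ T) (hij : i ≠ j) :
    sg i T * sg j (insert i T) = - (sg j T * sg i (insert j T)) := by
  rcases lt_or_gt_of_ne hij with h | h
  · rw [sg_insert_lt hi h, sg_insert_gt h]; ring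
  · rw [sg_insert_lt hj h, sg_insert_gt h]; ring

/-- truncation region -/
def Bk (k : ℕ) (t : Fin 3 → ℕ) : Prop := ∀ i : Fin 3, i.val < k → t i ≤ 3

instance (k t) : Decidable (Bk k t) := by unfold Bk; infer_instance

lemma Bk_mono {k : ℕ} {t t' : Fin 3 → ℕ} (h : Bk k t) (h' : t' ≤ t) : Bk k t' :=
  fun i hi => (h' i).trans (h i hi)

/-- Koszul differential in coordinates, truncated to the region `Bk k`. -/
noncomputable def dK (k : ℕ) : F →ₗ[ℂ] F where
  toFun f T t := if Bk k t then
    ∑ i, if i ∉ T ∧ ev i ≤ t then sg i T * f (insert i T) (t - ev i) else 0 else 0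
  map_add' f g := by
    ext T t
    simp only [Pi.add_apply]
    split_ifs
    · rw [← Finset.sum_add_distrib]
      refine Finset.sum_congr rfl fun i _ => ?_
      split_ifs <;> ring
    · simp
  map_smul' c f := by
    ext T t
    simp only [Pi.smul_apply, smul_eq_mul, RingHom.id_apply]
    split_ifs
    · rw [Finset.mul_sum]
      refine Finset.sum_congr rfl fun i _ => ?_
      split_ifs <;> ring
    · simp

lemma dK_apply (k f T t) : dK k f T t = if Bk k t then
    ∑ i, if i ∉ T ∧ ev i ≤ t then sg i T * f (insert i T) (t - ev i) else 0 else 0 := rfl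

lemma dK_dK (k : ℕ) (f : F) : dK k (dK k f) = 0 := by
  ext T t
  rw [dK_apply]
  split_ifs with hB
  swap
  · rfl
  have key : ∀ i, (if i ∉ T ∧ ev i ≤ t then sg i T * dK k f (insert i T) (t - ev i) else 0)
      = ∑ j, if (i ∉ T ∧ j ∉ T ∧ i ≠ j) ∧ ev i + ev j ≤ t then
        sg i T * sg j (insert i T) * f (insert j (insert i T)) (t - (ev i + ev j)) else 0 := by
    intro i
    split_ifs with h
    · rw [dK_apply, if_pos (Bk_mono hB tsub_le_self), Finset.mul_sum]
      refine Finset.sum_congr rfl fun j _ => ?_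
      have e1 : (j ∉ insert i T ∧ ev j ≤ t - ev i) ↔
        ((i ∉ T ∧ j ∉ T ∧ i ≠ j) ∧ ev i + ev j ≤ t) := by
        rw [le_tsub_iff_left h.2]
        simp only [Finset.mem_insert, not_or]
        have := h.1
        tauto
      by_cases h1 : (i ∉ T ∧ j ∉ T ∧ i ≠ j) ∧ ev i + ev j ≤ t
      · rw [if_pos h1, if_pos (e1.2 h1), tsub_tsub]; ring
      · rw [if_neg h1, if_neg (fun h => h1 (e1.1 h))]; ring
    · refine (Finset.sum_eq_zero fun j _ => if_neg ?_).symm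
      rintro ⟨⟨h1, -, -⟩, h2⟩
      exact h ⟨h1, le_trans (le_add_of_nonneg_right zero_le) h2⟩
  simp_rw [key]
  have : ∀ S : ℂ, S = -S → S = 0 := fun S hS => by linear_combination hS / 2
  refine this _ ?_
  conv_lhs => rw [Finset.sum_comm]
  rw [← Finset.sum_neg_distrib]
  refine Finset.sum_congr rfl fun i _ => ?_
  rw [← Finset.sum_neg_distrib]
  refine Finset.sum_congr rfl fun j _ => ?_
  by_cases h1 : (i ∉ T ∧ j ∉ T ∧ i ≠ j) ∧ ev i + ev j ≤ t
  · have h2 : (j ∉ T ∧ i ∉ T ∧ j ≠ i) ∧ ev j + ev i ≤ t :=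
      ⟨⟨h1.1.2.1, h1.1.1, h1.1.2.2.symm⟩, by rw [add_comm]; exact h1.2⟩
    rw [if_pos h1, if_pos h2, Finset.insert_comm, add_comm (ev j), sg_anti h2.1.1 h1.1.1 h2.1.2.2]
    ring
  · have h2 : ¬ ((j ∉ T ∧ i ∉ T ∧ j ≠ i) ∧ ev j + ev i ≤ t) := fun h =>
      h1 ⟨⟨h.1.2.1, h.1.1, h.1.2.2.symm⟩, by rw [add_comm]; exact h.2⟩
    rw [if_neg h1, if_neg h2, neg_zero]

/-- graded pieces of the `k`-th reduced complex -/
def Cell (k p : ℕ) (e : ℤ) (T : Finset (Fin 15)) (t : Fin 3 → ℕ) : Prop :=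
  (∀ i ∈ T, i.val < 15 - k) ∧ Bk k t ∧ T.card = p ∧ ((∑ i, t i : ℕ) : ℤ) = e

def Supp (k p : ℕ) (e : ℤ) (f : F) : Prop := ∀ T t, f T t ≠ 0 → Cell k p e T t

def Ex (k p : ℕ) (e : ℤ) : Prop :=
  ∀ f, Supp k p e f → dK k f = 0 → ∃ w, Supp k (p + 1) (e - 4) w ∧ dK k w = f

lemma ev_sum (i : Fin 15) : ∑ j, ev i j = 4 := by revert i; decide

lemma sum_add_ev (t : Fin 3 → ℕ) (i : Fin 15) : ∑ j, (t + ev i) j = ∑ j, t j + 4 := by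
  simp only [Pi.add_apply]; rw [Finset.sum_add_distrib, ev_sum]

/-- differential preserves the pieces -/
lemma Supp.dK {k p e f} (hf : Supp k (p + 1) (e - 4) f) : Supp k p e (dK k f) := by
  intro T t h
  rw [dK_apply] at h
  split_ifs at h with hB
  swap
  · exact absurd rfl h
  obtain ⟨i, -, hi⟩ := Finset.exists_ne_zero_of_sum_ne_zero h
  split_ifs at hi with hc
  swap
  · exact absurd rfl hi
  obtain ⟨h1, h2, h3, h4⟩ := hf _ _ (right_ne_zero_of_mul hi)
  refine ⟨fun j hj => h1 j (Finset.mem_insert_of_mem hj), hB, ?_, ?_⟩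
  · rw [Finset.card_insert_of_notMem hc.1] at h3; omega
  · have := sum_add_ev (t - ev i) i
    rw [tsub_add_cancel_of_le hc.2] at this
    omega

lemma Supp.sub {k p e f g} (hf : Supp k p e f) (hg : Supp k p e g) : Supp k p e (f - g) := by
  intro T t h
  by_cases h1 : f T t = 0
  · by_cases h2 : g T t = 0
    · exact absurd (by simp [h1, h2]) h
    · exact hg _ _ h2
  · exact hf _ _ h1

/-- the index of the `k`-th pure power -/
def ui (k : ℕ) (hk : k < 3) : Fin 15 := ⟨14 - k, by omega⟩

lemma ev_ui (k : ℕ) (hk : k < 3) : ev (ui k hk) = Pi.single ⟨k, hk⟩ 4 := by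
  interval_cases k <;> (funext i; fin_cases i <;> rfl)

lemma ui_le (k : ℕ) (hk : k < 3) (t) : ev (ui k hk) ≤ t ↔ 4 ≤ t ⟨k, hk⟩ := by
  rw [ev_ui]
  constructor
  · intro h; simpa using h ⟨k, hk⟩
  · intro h i
    by_cases hi : i = ⟨k, hk⟩
    · subst hi; simpa using h
    · simp [hi]

lemma Bk_succ (k : ℕ) (hk : k < 3) (t) : Bk (k + 1) t ↔ Bk k t ∧ ¬ ev (ui k hk) ≤ t := by
  rw [ui_le]
  constructor
  · intro h
    exact ⟨fun i hi => h i (by omega), by have := h ⟨k, hk⟩ (by simp); omega⟩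
  · rintro ⟨h1, h2⟩ i hi
    rcases Nat.lt_succ_iff_lt_or_eq.1 hi with h | h
    · exact h1 i h
    · have : i = ⟨k, hk⟩ := Fin.ext h
      subst this; omega

lemma Bk_add_ui (k : ℕ) (hk : k < 3) (t) : Bk k (t + ev (ui k hk)) ↔ Bk k t := by
  rw [ev_ui]
  refine forall_congr' fun i => forall_congr' fun hi => ?_
  have : i ≠ ⟨k, hk⟩ := fun h => by rw [h] at hi; simp at hi
  simp [this]

lemma step (k p : ℕ) (e : ℤ) (hk : k < 3) (H : Ex (k + 1) p e) : Ex k p e := by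
  intro f hf hdf
  set u := ui k hk with hu
  have huval : u.val = 14 - k := rfl
  -- restriction
  let fb : F := fun T t => if u ∉ T ∧ ¬ ev u ≤ t then f T t else 0
  have hfb : Supp (k + 1) p e fb := by
    intro T t h
    simp only [fb] at h
    split_ifs at h with hc
    · obtain ⟨h1, h2, h3, h4⟩ := hf _ _ h
      refine ⟨fun i hi => ?_, (Bk_succ k hk t).2 ⟨h2, hc.2⟩, h3, h4⟩
      have := h1 i hi
      have : i ≠ u := fun hh => hc.1 (hh ▸ hi)
      have : i.val ≠ u.val := fun hh => this (Fin.ext hh)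
      omega
    · exact absurd rfl h
  have hdfb : dK (k + 1) fb = 0 := by
    ext T t
    rw [dK_apply]
    split_ifs with hB
    swap
    · rfl
    have hB' := (Bk_succ k hk t).1 hB
    by_cases huT : u ∈ T
    · refine Finset.sum_eq_zero fun i _ => ?_
      have : fb (insert i T) (t - ev i) = 0 := if_neg (fun h => h.1 (Finset.mem_insert_of_mem huT))
      rw [this]; simp
    · have h0 := congrFun (congrFun hdf T) t
      rw [dK_apply, if_pos hB'.1] at h0
      rw [Pi.zero_apply, Pi.zero_apply] at h0 ⊢
      refine Eq.trans ?_ h0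
      refine Finset.sum_congr rfl fun i _ => ?_
      by_cases hc : i ∉ T ∧ ev i ≤ t
      · rw [if_pos hc, if_pos hc]
        congr 1
        refine if_pos ⟨?_, fun h => hB'.2 (h.trans tsub_le_self)⟩
        rw [Finset.mem_insert, not_or]
        exact ⟨fun h => hB'.2 (by rw [← hu, h]; exact hc.2), huT⟩
      · rw [if_neg hc, if_neg hc]
  obtain ⟨w, hw, hdw⟩ := H fb hfb hdfb
  have hwu : ∀ T t, u ∈ T → w T t = 0 := by
    intro T t h
    by_contra h0
    have := (hw _ _ h0).1 u h
    omega
  have hwS : Supp k (p + 1) (e - 4) w := by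
    intro T t h
    obtain ⟨h1, h2, h3, h4⟩ := hw _ _ h
    exact ⟨fun i hi => by have := h1 i hi; omega, ((Bk_succ k hk t).1 h2).1, h3, h4⟩
  let y : F := f - dK k w
  have hyS : Supp k p e y := hf.sub hwS.dK
  let W : F := fun T t => if u ∈ T then sg u (T.erase u) * y (T.erase u) (t + ev u) else w T t
  have hWS : Supp k (p + 1) (e - 4) W := by
    intro T t h
    simp only [W] at h
    split_ifs at h with hc
    · obtain ⟨h1, h2, h3, h4⟩ := hyS _ _ (right_ne_zero_of_mul h)
      refine ⟨fun i hi => ?_, (Bk_add_ui k hk t).1 h2, ?_, ?_⟩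
      · by_cases hi' : i = u
        · rw [hi']; omega
        · exact h1 i (Finset.mem_erase.2 ⟨hi', hi⟩)
      · rw [← h3, Finset.card_erase_add_one hc]
      · rw [sum_add_ev] at h4; omega
    · exact hwS _ _ h
  refine ⟨W, hWS, ?_⟩
  have hWd : ∀ T t, u ∉ T → dK k W T t = f T t := by
    intro T t huT
    by_cases hB : Bk k t
    swap
    · rw [dK_apply, if_neg hB]
      by_contra h
      exact hB (hf _ _ (Ne.symm h)).2.1
    have e1 : dK k W T t = dK k w T t +
        (if ev u ≤ t then y T t else 0) := by
      rw [dK_apply, dK_apply, if_pos hB, if_pos hB]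
      rw [← Finset.add_sum_erase _ _ (Finset.mem_univ u), ← Finset.add_sum_erase (a := u) (s := Finset.univ)
        (f := fun i => if i ∉ T ∧ ev i ≤ t then sg i T * w (insert i T) (t - ev i) else 0)
        (Finset.mem_univ u)]
      have e2 : ∀ i ∈ Finset.univ.erase u, (if i ∉ T ∧ ev i ≤ t then sg i T * W (insert i T) (t - ev i) else 0)
         = (if i ∉ T ∧ ev i ≤ t then sg i T * w (insert i T) (t - ev i) else 0) := by
        intro i hi
        have hi' : i ≠ u := (Finset.mem_erase.1 hi).1
        have : W (insert i T) (t - ev i) = w (insert i T) (t - ev i) := if_neg (by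
          rw [Finset.mem_insert, not_or]; exact ⟨fun h => hi' h.symm, huT⟩)
        rw [this]
      rw [Finset.sum_congr rfl e2]
      have e3 : w (insert u T) (t - ev u) = 0 := hwu _ _ (Finset.mem_insert_self _ _)
      rw [e3]
      by_cases hc : ev u ≤ t
      · rw [if_pos ⟨huT, hc⟩, if_pos ⟨huT, hc⟩, if_pos hc]
        have : W (insert u T) (t - ev u) = sg u T * y T t := by
          simp only [W]
          rw [if_pos (Finset.mem_insert_self _ _), Finset.erase_insert huT, tsub_add_cancel_of_le hc]
        rw [this, ← mul_assoc, sg_sq]; ring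
      · rw [if_neg hc]; simp [hc]
    rw [e1]
    split_ifs with hc
    · simp [y]
    · have e4 : dK k w T t = dK (k + 1) w T t := by
        rw [dK_apply, dK_apply, if_pos hB, if_pos ((Bk_succ k hk t).2 ⟨hB, hc⟩)]
      rw [e4, hdw]
      simp [fb, huT, hc]
  -- the difference vanishes
  have hg : dK k (f - dK k W) = 0 := by rw [map_sub, hdf, dK_dK, sub_zero]
  have hgS : Supp k p e (f - dK k W) := hf.sub hWS.dK
  ext T t
  by_cases huT : u ∈ T
  swap
  · exact hWd T t huT
  have h0 := congrFun (congrFun hg (T.erase u)) (t + ev u)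
  rw [dK_apply] at h0
  by_cases hB : Bk k t
  swap
  · by_contra h
    exact hB (hgS T t (fun h' => h (by
      have : f T t - dK k W T t = 0 := h'
      exact (sub_eq_zero.1 this).symm))).2.1
  rw [if_pos ((Bk_add_ui k hk t).2 hB), Finset.sum_eq_single u] at h0
  · rw [if_pos ⟨Finset.notMem_erase _ _, le_add_of_nonneg_left zero_le⟩, Finset.insert_erase huT,
      add_tsub_cancel_right] at h0
    have := (mul_eq_zero.1 h0).resolve_left (sg_ne _ _)
    exact (sub_eq_zero.1 this).symm
  · intro i _ hi
    split_ifs with hc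
    · have : (f - dK k W) (insert i (T.erase u)) (t + ev u - ev i) = 0 := by
        rw [Pi.sub_apply, Pi.sub_apply, hWd, sub_self]
        rw [Finset.mem_insert, not_or]
        exact ⟨fun h => hi h.symm, Finset.notMem_erase _ _⟩
      rw [this, mul_zero]
    · rfl
  · intro h; exact absurd (Finset.mem_univ _) h

lemma Ex_of_three {p e} (H : Ex 3 p e) : Ex 0 p e :=
  step 0 p e (by norm_num) (step 1 p e (by norm_num) (step 2 p e (by norm_num) H))

end VB

set_option maxHeartbeats 400000
namespace VB

/-! ### a mod 2 elimination checker -/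

/-- evaluate the number, then continue -/
def frc {α : Type} (n : ℕ) (f : ℕ → α) : α := Nat.rec (f 0) (fun m _ => f (m + 1)) n

lemma frc_eq {α : Type} (n : ℕ) (f : ℕ → α) : frc n f = f n := by cases n <;> rfl

/-- xor of the relation masks with the given labels -/
def xorAll (rel : ℕ → ℕ) : List ℕ → ℕ
  | [] => 0
  | i :: l => rel i ^^^ xorAll rel l

/-- the mask of bits which have been shown to vanish modulo 2; each step of the certificate
is a bit and a list of relations isolating it -/
def run (rel : ℕ → ℕ) : List (ℕ × List ℕ) → ℕ → ℕ
  | [], K => K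
  | l :: ls, K =>
      cond (Nat.beq ((xorAll rel l.2 ||| K) ^^^ K) (Nat.pow 2 l.1))
        (frc (K ||| Nat.pow 2 l.1) (run rel ls)) 0

section checker
variable {Q : Type*} [AddCommGroup Q] (P : AddSubgroup Q) (N : ℕ) (a : ℕ → Q)

/-- value of a mask -/
def mval (r : ℕ) : Q := ∑ x ∈ Finset.range N, if r.testBit x then a x else 0

lemma mval_xor (h2 : ∀ x, a x + a x ∈ P) {r s : ℕ} : mval N a (r ^^^ s) - (mval N a r + mval N a s) ∈ P := by
  unfold mval
  rw [← Finset.sum_add_distrib, ← Finset.sum_sub_distrib]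
  refine P.sum_mem fun x _ => ?_
  rw [Nat.testBit_xor]
  cases r.testBit x <;> cases s.testBit x <;> simp [P.zero_mem]
  simpa using P.neg_mem (h2 x)

lemma mval_xor_mem (h2 : ∀ x, a x + a x ∈ P)
    {r s : ℕ} (hr : mval N a r ∈ P) (hs : mval N a s ∈ P) :
    mval N a (r ^^^ s) ∈ P := by
  have := P.add_mem (mval_xor P N a h2 (r := r) (s := s)) (P.add_mem hr hs)
  simpa using this

lemma mval_zero : mval N a 0 = 0 := by simp [mval]

lemma mval_pow {x : ℕ} (hx : x < N) : mval N a (2 ^ x) = a x := by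
  unfold mval
  rw [Finset.sum_eq_single x]
  · simp
  · intro y _ hy
    rw [Nat.testBit_two_pow]
    simp [hy.symm]
  · intro h; exact absurd (Finset.mem_range.2 hx) h

lemma mval_xorAll (h2 : ∀ x, a x + a x ∈ P)
    (rel : ℕ → ℕ) (hrel : ∀ i, mval N a (rel i) ∈ P) (l : List ℕ) : mval N a (xorAll rel l) ∈ P := by
  induction l with
  | nil => rw [xorAll, mval_zero]; exact P.zero_mem
  | cons i l ih => exact mval_xor_mem P N a h2 (hrel i) ih

lemma run_sound (h2 : ∀ x, a x + a x ∈ P)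
    (rel : ℕ → ℕ) (hrel : ∀ i, mval N a (rel i) ∈ P)
    (ls : List (ℕ × List ℕ)) (K : ℕ) (hK : ∀ x < N, K.testBit x → a x ∈ P) :
    ∀ x < N, (run rel ls K).testBit x → a x ∈ P := by
  induction ls generalizing K with
  | nil => exact hK
  | cons l ls ih =>
    rw [run]
    cases hb : Nat.beq ((xorAll rel l.2 ||| K) ^^^ K) (Nat.pow 2 l.1) with
    | false => simp
    | true =>
      rw [cond_true, frc_eq]
      apply ih
      intro x hx hxK
      rw [Nat.testBit_or, Bool.or_eq_true] at hxK
      rcases hxK with h | h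
      · exact hK x hx h
      · have hr : (xorAll rel l.2 ||| K) ^^^ K = 2 ^ l.1 := Nat.eq_of_beq_eq_true hb
        have h : (2 ^ l.1).testBit x = true := h
        rw [Nat.testBit_two_pow, decide_eq_true_eq] at h
        rw [h] at hr
        have h1 : mval N a ((xorAll rel l.2 ||| K) ^^^ K) - mval N a (xorAll rel l.2) ∈ P := by
          unfold mval
          rw [← Finset.sum_sub_distrib]
          refine P.sum_mem fun y hy => ?_
          have := hK y (Finset.mem_range.1 hy)
          rw [Nat.testBit_xor, Nat.testBit_or]
          cases hKy : K.testBit y <;> cases (xorAll rel l.2).testBit y <;> simp [P.zero_mem]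
          exact this hKy
        have h3 := P.add_mem h1 (mval_xorAll P N a h2 rel hrel l.2)
        rw [sub_add_cancel, hr, mval_pow N a hx] at h3
        exact h3

end checker

/-- mod 2 Nakayama -/
lemma nak {Q : Type*} [AddCommGroup Q] [Module ℂ Q] (s : Finset Q)
    (h : ∀ x ∈ s, ∃ y ∈ AddSubgroup.closure (s : Set Q), x = y + y) : ∀ x ∈ s, x = 0 := by
  let G : Submodule ℤ Q := Submodule.span ℤ (s : Set Q)
  have hG : ∀ y, y ∈ AddSubgroup.closure (s : Set Q) → y ∈ G := by
    intro y hy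
    have : AddSubgroup.closure (s : Set Q) ≤ G.toAddSubgroup :=
      (AddSubgroup.closure_le _).2 Submodule.subset_span
    exact this hy
  have hle : G ≤ (Ideal.span {(2 : ℤ)}) • G := by
    refine Submodule.span_le.2 fun x hx => ?_
    obtain ⟨y, hy, rfl⟩ := h x hx
    rw [← two_smul ℤ]
    exact Submodule.smul_mem_smul (Ideal.mem_span_singleton_self _) (hG y hy)
  obtain ⟨r, hr, hr0⟩ := Submodule.exists_sub_one_mem_and_smul_eq_zero_of_fg_of_le_smul
    (Ideal.span {(2 : ℤ)}) G (Submodule.fg_span s.finite_toSet) hle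
  intro x hx
  have h0 := hr0 x (Submodule.subset_span hx)
  rw [Ideal.mem_span_singleton] at hr
  have hr' : r ≠ 0 := by rintro rfl; omega
  have : (r : ℂ) • x = 0 := by rw [Int.cast_smul_eq_zsmul]; exact h0
  exact (smul_eq_zero.1 this).resolve_left (by exact_mod_cast hr')

/-- the subgroup of doubles -/
def dbl {Q : Type*} [AddCommGroup Q] (G : AddSubgroup Q) : AddSubgroup Q where
  carrier := {x | ∃ y ∈ G, x = y + y}
  zero_mem' := ⟨0, G.zero_mem, by simp⟩
  add_mem' := by
    rintro _ _ ⟨x, hx, rfl⟩ ⟨y, hy, rfl⟩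
    exact ⟨x + y, G.add_mem hx hy, by abel⟩
  neg_mem' := by
    rintro _ ⟨x, hx, rfl⟩
    exact ⟨-x, G.neg_mem hx, by abel⟩

/-- the three cubic socle monomials of degree 8 -/
def tau : Fin 3 → Fin 3 → ℕ := ![![2,3,3], ![3,2,3], ![3,3,2]]

end VB

set_option maxHeartbeats 400000
namespace VB

/-- table of partners: `pr m k = j` when `ev m + ev j = tau k`, and `12` if there is none -/
def prL : List ℕ :=
  [12, 11, 10, 12, 10, 9, 11, 8, 7, 10, 7, 6, 9, 6, 5, 8, 12, 4, 7, 4, 3, 6, 3, 2, 5, 2, 12,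
   4, 12, 1, 3, 1, 0, 2, 0, 12]

def pr (m k : ℕ) : ℕ := prL.getD (3 * m + k) 12

lemma pr_iff : ∀ (m j : Fin 15) (k : Fin 3), m.val < 12 → j.val < 12 →
    (j.val = pr m.val k.val ↔ ev m + ev j = tau k) := by decide +kernel

lemma Bk_iff : ∀ (m j : Fin 15), m.val < 12 → j.val < 12 →
    (Bk 3 (ev m + ev j) ↔ ∃ k, ev m + ev j = tau k) := by decide +kernel

lemma tau_inj : ∀ k k', tau k = tau k' → k = k' := by decide

lemma Bk_tau : ∀ k, Bk 3 (tau k) := by decide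

lemma sum_tau : ∀ k, ∑ i, tau k i = 8 := by decide

lemma Bk_ev : ∀ m : Fin 15, m.val < 12 → Bk 3 (ev m) := by decide

lemma eq_tau {t : Fin 3 → ℕ} (hB : Bk 3 t) (ht : ∑ i, t i = 8) : ∃ k, t = tau k := by
  have h0 := hB 0 (by decide)
  have h1 := hB 1 (by decide)
  have h2 := hB 2 (by decide)
  rw [Fin.sum_univ_three] at ht
  have : (t 0 = 2 ∧ t 1 = 3 ∧ t 2 = 3) ∨ (t 0 = 3 ∧ t 1 = 2 ∧ t 2 = 3) ∨
    (t 0 = 3 ∧ t 1 = 3 ∧ t 2 = 2) := by omega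
  rcases this with ⟨a, b, c⟩ | ⟨a, b, c⟩ | ⟨a, b, c⟩
  · exact ⟨0, by funext i; fin_cases i <;> [exact a; exact b; exact c]⟩
  · exact ⟨1, by funext i; fin_cases i <;> [exact a; exact b; exact c]⟩
  · exact ⟨2, by funext i; fin_cases i <;> [exact a; exact b; exact c]⟩

/-- one term of a relation mask -/
def termB (M m k : ℕ) : ℕ :=
  cond (Nat.blt (pr m k) 12 && !(M.testBit (pr m k))) (2 ^ (3 * (M ||| 2 ^ (pr m k)) + k)) 0

def relM (M m : ℕ) : ℕ := termB M m 0 ^^^ (termB M m 1 ^^^ termB M m 2)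

/-- the relation masks for `K_{9,2}` -/
def relB (i : ℕ) : ℕ := relM (2 ^ (i / 144 % 12) ||| 2 ^ (i / 12 % 12)) (i % 12)

def certB : List (ℕ × List ℕ) :=
  [(57,[21]), (33,[22]), (21,[23]), (111,[32]), (34,[46]), (39,[47]), (819,[53]), (59,[57]),
   (63,[59]), (112,[68]), (207,[83]), (399,[95]), (821,[101]), (779,[105]), (783,[107]),
   (4612,[109]), (1551,[119]), (9220,[120]), (4613,[121]), (3087,[131]), (9221,[132]),
   (7685,[133]), (6159,[143]), (114,[176]), (66,[177]), (22,[179]), (78,[189]), (35,[190]),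
   (42,[191]), (822,[197]), (58,[203]), (115,[212]), (150,[213]), (106,[215]), (246,[225]),
   (438,[237]), (824,[245]), (798,[250]), (4615,[253]), (1590,[261]), (9223,[264]), (4616,[265]),
   (3126,[273]), (9224,[276]), (7688,[277]), (6198,[285]), (228,[331]), (132,[332]), (40,[335]),
   (828,[341]), (156,[344]), (68,[345]), (64,[347]), (116,[357]), (113,[358]), (229,[367]),
   (300,[368]), (208,[371]), (492,[380]), (400,[383]), (830,[389]), (876,[392]), (788,[393]),
   (784,[395]), (4621,[397]), (1644,[404]), (1552,[407]), (9229,[408]), (4622,[409]),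
   (3180,[416]), (3088,[419]), (9230,[420]), (7694,[421]), (6252,[428]), (6160,[431]),
   (840,[485]), (456,[486]), (80,[489]), (133,[500]), (124,[503]), (230,[511]), (312,[512]),
   (220,[515]), (457,[522]), (416,[525]), (842,[533]), (800,[537]), (4633,[541]), (9241,[552]),
   (4634,[553]), (9242,[564]), (7706,[565]), (912,[641]), (157,[644]), (152,[645]), (148,[647]),
   (1008,[653]), (248,[657]), (1200,[665]), (458,[666]), (440,[669]), (841,[679]), (829,[680]),
   (823,[682]), (820,[683]), (4657,[685]), (2352,[689]), (1592,[693]), (9265,[696]),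
   (4658,[697]), (3888,[701]), (3128,[705]), (9266,[708]), (7730,[709]), (6960,[713]),
   (6200,[717]), (1824,[796]), (301,[800]), (292,[803]), (493,[812]), (484,[815]), (914,[821]),
   (877,[824]), (872,[825]), (868,[827]), (4705,[829]), (1825,[832]), (1645,[836]), (1636,[839]),
   (9313,[840]), (4706,[841]), (3181,[848]), (3172,[851]), (9314,[852]), (7778,[853]),
   (6253,[860]), (6244,[863]), (3648,[951]), (1010,[965]), (968,[969]), (4801,[973]),
   (1826,[976]), (1741,[980]), (9409,[984]), (4802,[985]), (3649,[987]), (9410,[996]),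
   (7874,[997]), (7296,[1106]), (1202,[1109]), (1160,[1113]), (4993,[1117]), (9601,[1128]),
   (4994,[1129]), (3650,[1131]), (9602,[1140]), (8066,[1141]), (7297,[1142]), (6578,[1145]),
   (5377,[1261]), (2354,[1265]), (2312,[1269]), (9985,[1272]), (5378,[1273]), (3890,[1277]),
   (3848,[1281]), (9986,[1284]), (8450,[1285]), (7298,[1286]), (6962,[1289]), (6920,[1293]),
   (10753,[1416]), (10752,[1418]), (5376,[1421]), (4992,[1422]), (4800,[1423]), (4704,[1424]),
   (4656,[1425]), (4632,[1426]), (4620,[1427]), (10754,[1428]), (8449,[1430]), (8065,[1431]),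
   (7873,[1432]), (8448,[1433]), (7728,[1437]), (9984,[1577]), (9600,[1578]), (9408,[1579]),
   (9312,[1580]), (9264,[1581]), (9240,[1582]), (9228,[1583]), (777,[17]), (393,[18]),
   (105,[20]), (3089,[24]), (1553,[25]), (401,[26]), (209,[27]), (65,[29]), (41,[30]), (23,[33]),
   (219,[43]), (123,[44]), (75,[45]), (147,[56]), (3173,[60]), (1637,[61]), (1635,[64]),
   (291,[67]), (107,[69]), (202,[82]), (483,[92]), (867,[104]), (7684,[108]), (1732,[112]),
   (3171,[128]), (6243,[140]), (786,[173]), (6199,[192]), (3127,[193]), (439,[195]), (247,[196]),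
   (79,[199]), (67,[200]), (870,[209]), (126,[214]), (966,[221]), (210,[227]), (1158,[233]),
   (6919,[240]), (3847,[241]), (6918,[242]), (799,[247]), (787,[248]), (778,[251]), (7687,[252]),
   (2310,[257]), (3846,[269]), (6536,[278]), (43,[334]), (84,[346]), (3182,[348]), (1646,[349]),
   (494,[350]), (302,[351]), (158,[353]), (134,[354]), (1740,[364]), (211,[370]), (7693,[396]),
   (1573,[403]), (3277,[412]), (6216,[482]), (77,[490]), (76,[491]), (1176,[521]), (797,[538]),
   (7705,[540]), (1656,[548]), (6176,[573]), (437,[670]), (6961,[672]), (3889,[673]),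
   (1201,[675]), (1009,[676]), (7729,[684]), (3506,[698]), (6197,[718]), (3361,[793]),
   (313,[799]), (7777,[828]), (2017,[831]), (1657,[835]), (1639,[838]), (6721,[948]),
   (2114,[949]), (2113,[975]), (4033,[986]), (3362,[988]), (3360,[992]), (4226,[1104]),
   (1178,[1110]), (2018,[1120]), (4225,[1130]), (3554,[1132]), (4224,[1133]), (6722,[1143]),
   (6576,[1149]), (2690,[1262]), (4034,[1275]), (3938,[1276]), (3866,[1278]), (7106,[1287]),
   (6938,[1290]), (8064,[1434]), (7872,[1435]), (7776,[1436]), (7704,[1438]), (7692,[1439]),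
   (1545,[16]), (201,[19]), (795,[41]), (411,[42]), (6195,[50]), (435,[54]), (243,[55]),
   (485,[62]), (293,[63]), (149,[65]), (125,[66]), (1731,[76]), (203,[81]), (1155,[89]),
   (395,[93]), (394,[94]), (1564,[115]), (6915,[137]), (6155,[141]), (1554,[172]), (6174,[182]),
   (414,[186]), (294,[224]), (222,[226]), (402,[239]), (1159,[243]), (967,[244]), (1546,[263]),
   (6534,[282]), (1572,[328]), (44,[333]), (1742,[361]), (1933,[399]), (1555,[406]), (127,[502]),
   (6937,[528]), (6936,[530]), (6554,[566]), (6218,[569]), (6577,[660]), (6386,[711]),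
   (6433,[792]), (673,[795]), (295,[802]), (6625,[804]), (3553,[805]), (2016,[808]),
   (7009,[816]), (2401,[830]), (3937,[842]), (3193,[847]), (6626,[854]), (6434,[855]),
   (7105,[960]), (2498,[961]), (2497,[974]), (1753,[979]), (7104,[1001]), (1346,[1107]),
   (1157,[1114]), (2689,[1118]), (2402,[1264]), (7010,[1288]), (6926,[1291]), (6917,[1294]),
   (6153,[14]), (3081,[15]), (1563,[40]), (1638,[208]), (1658,[493]), (1681,[834]),
   (963,[103,394,539]), (245,[77]), (264,[658]), (86,[487]), (224,[513]), (582,[222]),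
   (804,[329]), (444,[342]), (404,[381]), (785,[394]), (796,[539]), (436,[671]), (3123,[51]),
   (413,[90]), (3083,[129]), (6162,[170]), (415,[235]), (3102,[274]), (6154,[287]), (6171,[38]),
   (6344,[228,266,279]), (6384,[1005]), (626,[650]), (3504,[663]), (3146,[702]), (1344,[953]),
   (986,[966]), (3464,[1137]), (6535,[228]), (9222,[266]), (6217,[480]), (3864,[557]),
   (6552,[570]), (6206,[715]), (6533,[1150]), (3845,[1282]), (6916,[96]), (6924,[425]),
   (1177,[518]), (1166,[1111]), (1924,[73,111,124]), (1932,[1127]), (589,[376]), (672,[956]),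
   (3276,[363]), (3109,[415]), (3192,[560]), (505,[811]), (3175,[850]), (3268,[995]),
   (1733,[73]), (4611,[111]), (1640,[205]), (1735,[256]), (1574,[325]), (1597,[402]),
   (314,[495]), (1752,[508]), (1680,[692]), (337,[798]), (6265,[424,859,1004]), (3194,[492]),
   (3289,[556]), (3278,[991]), (6349,[360]), (3469,[411]), (6254,[424]), (1754,[505]),
   (1945,[543]), (6432,[859]), (3552,[1136]), (1934,[373]), (2317,[398]), (674,[807]),
   (3217,[846]), (2112,[952]), (1777,[978]), (2400,[1268]), (1682,[637]), (1057,[794]),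
   (2330,[686,1121,1266]), (3865,[529]), (3482,[554]), (3505,[1134]), (6553,[516]), (6362,[567]),
   (1970,[661]), (2353,[686]), (3314,[699]), (4032,[989]), (2688,[1121]), (3854,[1279]),
   (6925,[384]), (6542,[422]), (6385,[648]), (6290,[712]), (7008,[857]), (1345,[963]),
   (6720,[1002]), (1250,[1108]), (486,[210,501,646]), (403,[236]), (420,[382]), (412,[527]),
   (579,[91]), (85,[330]), (252,[343]), (212,[369]), (168,[488]), (128,[501]), (151,[646]),
   (244,[659]), (1587,[52]), (221,[78]), (1547,[117]), (3090,[171]), (223,[223]), (1566,[262]),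
   (3082,[275]), (3099,[39]), (3174,[207,498,643,801,814]), (3091,[272]), (3108,[418]),
   (3100,[563]), (1565,[37]), (3267,[127]), (1556,[169]), (421,[327]), (588,[379]), (1596,[405]),
   (504,[524]), (1567,[550]), (1588,[695]), (487,[814]), (580,[959]), (1923,[88]), (296,[207]),
   (1734,[220]), (253,[340]), (169,[498]), (336,[643]), (3134,[519,558,651,703,954]),
   (6205,[336]), (3852,[413]), (6288,[716]), (6248,[861]), (3844,[1283]), (2309,[97]),
   (890,[638,809,822]), (6341,[84,122,135]), (3132,[339,378,510,523,655]), (3092,[417]),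
   (3124,[707]), (1589,[49]), (2307,[113]), (6163,[168]), (6246,[284]), (6339,[139,430,575]),
   (1926,[258,549,694]), (3133,[375,414,507,559,955]), (1598,[337]), (2316,[401]), (3216,[704]),
   (3176,[849]), (2308,[1271]), (6247,[204]), (1927,[217,255,268]), (889,[388,823,968]),
   (2318,[542,687,977,1122,1267]), (3853,[385]), (3470,[410]), (3481,[1135]), (3936,[1280]),
   (6541,[372]), (6350,[423]), (1946,[517]), (2329,[542]), (3290,[555]), (3218,[845]),
   (3313,[990]), (6361,[1003]), (1969,[1122]), (6624,[1148]), (2496,[1267]), (6266,[568]),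
   (6289,[636]), (1778,[649]), (1249,[806]), (1058,[819]), (871,[100,391,536,826,971]),
   (488,[206]), (583,[232]), (528,[813]), (3270,[219]), (3103,[271]), (3101,[562]), (170,[642]),
   (445,[668]), (6172,[36]), (3459,[126]), (6161,[139]), (1568,[181]), (1591,[258]), (254,[339]),
   (972,[365]), (422,[378]), (805,[391]), (6180,[430]), (888,[497]), (600,[523]), (1608,[549]),
   (265,[655]), (869,[826]), (581,[958]), (964,[971]), (6164,[180,218,231,270,283]),
   (6204,[429]), (6196,[719]), (3125,[48]), (3843,[125]), (446,[338]), (1164,[377]), (806,[390]),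
   (984,[535]), (624,[667]), (3144,[706]), (584,[957]), (965,[970]), (1156,[1115]), (6531,[86]),
   (6173,[138]), (6342,[218]), (3462,[231]), (3104,[270]), (6175,[283]), (266,[483]),
   (7686,[254,545,690,1125,1270]), (6343,[280]), (6360,[1006]), (3272,[216]), (3463,[267]),
   (6182,[571]), (3312,[993]), (1928,[229]), (2311,[254]), (6540,[426]), (625,[651]),
   (3145,[703]), (602,[954]), (1968,[1125]), (6532,[1151]), (2328,[1270]), (3461,[84]),
   (9219,[122]), (1165,[374]), (974,[387]), (1610,[481]), (985,[506]), (3480,[519]), (530,[664]),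
   (1248,[809]), (913,[822]), (7683,[136,427,572,862,1007]), (1925,[110]), (1944,[1126]),
   (3460,[85]), (3269,[123]), (1609,[546]), (1776,[691]), (1736,[981]), (3468,[1139]),
   (6340,[72]), (6245,[136]), (3271,[217]), (4614,[255]), (590,[375]), (3110,[414]),
   (3288,[559]), (338,[652]), (1056,[797]), (878,[823]), (6264,[862]), (601,[955]), (973,[968]),
   (6348,[1007]), (6181,[324]), (506,[494]), (529,[639])]

def finalB (K : ℕ) : Bool :=
  (List.range 12).all fun c1 => (List.range 12).all fun c2 => (List.range 12).all fun c3 =>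
    (List.range 3).all fun k =>
      Nat.beq c1 c2 || Nat.beq c1 c3 || Nat.beq c2 c3 ||
        K.testBit (3 * (2 ^ c1 ||| 2 ^ c2 ||| 2 ^ c3) + k)

lemma checkB : frc (run relB certB 0) finalB = true := by decide +kernel

/-- the relation masks for `K_{11,1}` -/
def relC' (j j' k : ℕ) : ℕ :=
  cond (Nat.beq j j') 0
    (cond (Nat.blt (pr j k) 12) (2 ^ (12 * j' + pr j k)) 0 ^^^
      cond (Nat.blt (pr j' k) 12) (2 ^ (12 * j + pr j' k)) 0)

def relC (i : ℕ) : ℕ := relC' (i / 36 % 12) (i / 3 % 12) (i % 3)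

def certC : List (ℕ × List ℕ) :=
  [(11,[6]), (10,[9]), (9,[12]), (8,[15]), (71,[16]), (7,[18]), (6,[21]), (5,[24]), (106,[26]),
   (4,[27]), (119,[28]), (3,[30]), (130,[32]), (2,[33]), (143,[34]), (142,[35]), (23,[42]),
   (22,[45]), (21,[48]), (20,[51]), (70,[52]), (19,[54]), (18,[57]), (17,[60]), (14,[61]),
   (105,[62]), (16,[63]), (118,[64]), (15,[66]), (13,[67]), (12,[70]), (141,[71]), (32,[87]),
   (68,[88]), (103,[98]), (28,[99]), (116,[100]), (26,[105]), (139,[107]), (44,[123]),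
   (67,[124]), (41,[132]), (38,[133]), (102,[134]), (40,[135]), (115,[136]), (39,[138]),
   (36,[142]), (138,[143]), (66,[160]), (53,[168]), (50,[169]), (101,[170]), (114,[172]),
   (48,[178]), (137,[179]), (80,[198]), (64,[199]), (92,[201]), (63,[202]), (62,[205]),
   (100,[206]), (128,[210]), (61,[211]), (140,[213]), (60,[214]), (136,[215]), (77,[240]),
   (74,[241]), (99,[242]), (76,[243]), (112,[244]), (72,[250]), (135,[251]), (89,[276]),
   (86,[277]), (98,[278]), (88,[279]), (111,[280]), (84,[286]), (134,[287]), (113,[315]),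
   (110,[316]), (97,[317]), (125,[318]), (122,[319]), (96,[320]), (124,[354]), (109,[355]),
   (108,[358]), (133,[359]), (120,[394]), (132,[395]), (35,[7]), (34,[8]), (47,[10]), (46,[11]),
   (59,[13]), (58,[14]), (83,[19]), (82,[20]), (95,[22]), (94,[23]), (107,[25]), (1,[29]),
   (131,[31]), (33,[44]), (45,[47]), (57,[50]), (69,[53]), (81,[56]), (93,[59]), (117,[65]),
   (129,[68]), (31,[82]), (30,[93]), (27,[94]), (91,[95]), (29,[96]), (104,[97]), (25,[101]),
   (24,[106]), (54,[122]), (43,[126]), (79,[127]), (78,[128]), (42,[129]), (90,[131]),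
   (37,[137]), (127,[139]), (126,[140]), (56,[159]), (55,[162]), (52,[163]), (51,[164]),
   (49,[173]), (65,[204]), (75,[238]), (87,[239]), (73,[245]), (123,[248]), (85,[281]),
   (121,[356])]

lemma checkC : run relC certC 1 = 2 ^ 144 - 1 := by decide +kernel

end VB

set_option maxHeartbeats 400000
namespace VB

/-- basis chain -/
noncomputable def dlt (T : Finset (Fin 15)) (t : Fin 3 → ℕ) : F :=
  fun S s => if S = T ∧ s = t then 1 else 0

lemma dK_dlt (k : ℕ) (T : Finset (Fin 15)) (t : Fin 3 → ℕ) :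
    dK k (dlt T t) = ∑ j, if j ∈ T ∧ Bk k (t + ev j) then
      sg j (T.erase j) • dlt (T.erase j) (t + ev j) else 0 := by
  ext S s
  rw [dK_apply, Finset.sum_apply, Finset.sum_apply]
  by_cases hB : Bk k s
  · rw [if_pos hB]
    refine Finset.sum_congr rfl fun i _ => ?_
    by_cases h : i ∈ T ∧ S = T.erase i ∧ s = t + ev i
    · obtain ⟨h1, rfl, rfl⟩ := h
      rw [if_pos ⟨Finset.notMem_erase _ _, le_add_of_nonneg_left zero_le⟩, if_pos ⟨h1, hB⟩]
      simp [dlt, Finset.insert_erase h1]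
    · have e1 : (if i ∉ S ∧ ev i ≤ s then sg i S * dlt T t (insert i S) (s - ev i) else 0) = 0 := by
        split_ifs with hc
        · have : dlt T t (insert i S) (s - ev i) = 0 := if_neg (by
            rintro ⟨rfl, rfl⟩
            exact h ⟨Finset.mem_insert_self _ _, (Finset.erase_insert hc.1).symm,
              (tsub_add_cancel_of_le hc.2).symm⟩)
          rw [this, mul_zero]
        · rfl
      rw [e1]
      split_ifs with hc
      · have : dlt (T.erase i) (t + ev i) S s = 0 := if_neg (fun h' => h ⟨hc.1, h'.1, h'.2⟩)
        simp [this]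
      · rfl
  · rw [if_neg hB]
    refine (Finset.sum_eq_zero fun j _ => ?_).symm
    split_ifs with hc
    · have : dlt (T.erase j) (t + ev j) S s = 0 := if_neg (by
        rintro ⟨-, rfl⟩; exact hB hc.2)
      simp [this]
    · rfl

lemma Supp_zero (k p e) : Supp k p e 0 := fun _ _ h => absurd rfl h

/-- graded piece as a submodule -/
def SuppM (k p : ℕ) (e : ℤ) : Submodule ℂ F where
  carrier := {f | Supp k p e f}
  zero_mem' := Supp_zero k p e
  add_mem' := by
    intro f g hf hg T t h
    by_cases h1 : f T t = 0
    · exact hg _ _ (fun h2 => h (by simp [h1, h2]))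
    · exact hf _ _ h1
  smul_mem' := by
    intro c f hf T t h
    exact hf _ _ (right_ne_zero_of_mul h)

lemma Supp_dlt {k p e T t} (h : Cell k p e T t) : Supp k p e (dlt T t) := by
  intro S s hs
  unfold dlt at hs
  split_ifs at hs with hc
  · rw [hc.1, hc.2]; exact h
  · exact absurd rfl hs

lemma Ex_of_zero {k p e} (h : ∀ T t, ¬ Cell k p e T t) : Ex k p e := by
  intro f hf _
  refine ⟨0, Supp_zero _ _ _, ?_⟩
  rw [map_zero]
  ext T t
  by_contra h0
  exact h T t (hf T t (Ne.symm h0))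

/-- the twelve variables of the Artinian reduction -/
def J : Finset (Fin 15) := Finset.univ.filter (fun i => i.val < 12)

lemma mem_J {i} : i ∈ J ↔ i.val < 12 := by simp [J]

lemma card_J : J.card = 12 := by decide

lemma Ex3_neg {p e} (h : e < 0) : Ex 3 p e := Ex_of_zero fun T t hc => by
  have := hc.2.2.2; omega

lemma Ex3_large {p e} (h : 9 < e) : Ex 3 p e := Ex_of_zero fun T t hc => by
  have h0 := hc.2.1 0 (by decide)
  have h1 := hc.2.1 1 (by decide)
  have h2 := hc.2.1 2 (by decide)
  have := hc.2.2.2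
  rw [Fin.sum_univ_three] at this
  omega

lemma Ex3_p {p e} (h : 12 < p) : Ex 3 p e := Ex_of_zero fun T t hc => by
  have : T ⊆ J := fun i hi => mem_J.2 (by simpa using hc.1 i hi)
  have := Finset.card_le_card this
  rw [card_J, hc.2.2.1] at this
  omega

lemma ev_le : ∀ i j : Fin 15, ev j ≤ ev i → j = i := by decide +kernel

lemma Ex3_zero {p} (h : 0 < p) : Ex 3 p 0 := by
  intro f hf hdf
  refine ⟨0, Supp_zero _ _ _, ?_⟩
  rw [map_zero]
  ext T t
  by_contra h0
  have hne : f T t ≠ 0 := Ne.symm h0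
  obtain ⟨h1, h2, h3, h4⟩ := hf T t hne
  have ht : t = 0 := by
    have : ∑ i, t i = 0 := by exact_mod_cast h4
    rw [Finset.sum_eq_zero_iff] at this
    funext i; exact this i (Finset.mem_univ _)
  subst ht
  obtain ⟨i, hi⟩ : T.Nonempty := Finset.card_pos.1 (by omega)
  have := congrFun (congrFun hdf (T.erase i)) (ev i)
  rw [dK_apply, if_pos (Bk_ev i (by simpa using h1 i hi)), Finset.sum_eq_single i] at this
  · rw [if_pos ⟨Finset.notMem_erase _ _, le_rfl⟩, Finset.insert_erase hi, tsub_self] at this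
    exact hne ((mul_eq_zero.1 this).resolve_left (sg_ne _ _))
  · intro j _ hj
    exact if_neg (fun h => hj (ev_le _ _ h.2))
  · intro h; exact absurd (Finset.mem_univ _) h

lemma sg_cases (i T) : sg i T = 1 ∨ sg i T = -1 := by
  unfold sg; exact neg_one_pow_eq_or ℂ _

lemma exB {p : ℕ} (hp : p ≤ 9) : Ex 3 p 8 := by
  classical
  let I : Submodule ℂ F := (SuppM 3 (p + 1) 4).map (dK 3)
  suffices H : ∀ T ⊆ J, T.card = p → ∀ k, dlt T (tau k) ∈ I by
    intro f hf _
    have hfI : f ∈ I := by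
      have : f = ∑ T ∈ J.powersetCard p, ∑ k, f T (tau k) • dlt T (tau k) := by
        ext S s
        rw [Finset.sum_apply, Finset.sum_apply]
        simp only [Finset.sum_apply, Pi.smul_apply, smul_eq_mul]
        by_cases hs : f S s = 0
        · rw [hs]
          refine (Finset.sum_eq_zero fun T _ => Finset.sum_eq_zero fun k _ => ?_).symm
          unfold dlt
          split_ifs with hc
          · rw [← hc.1, ← hc.2, hs, zero_mul]
          · rw [mul_zero]
        · obtain ⟨h1, h2, h3, h4⟩ := hf _ _ hs
          obtain ⟨k, rfl⟩ := eq_tau h2 (by exact_mod_cast h4)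
          rw [Finset.sum_eq_single S, Finset.sum_eq_single k]
          · simp [dlt]
          · intro k' _ hk'
            have : dlt S (tau k') S (tau k) = 0 := if_neg fun h => hk' (tau_inj _ _ h.2.symm)
            rw [this, mul_zero]
          · intro h; exact absurd (Finset.mem_univ _) h
          · intro T _ hT
            refine Finset.sum_eq_zero fun k' _ => ?_
            have : dlt T (tau k') S (tau k) = 0 := if_neg fun h => hT h.1.symm
            rw [this, mul_zero]
          · intro h
            exact absurd (Finset.mem_powersetCard.2
              ⟨fun i hi => mem_J.2 (by simpa using h1 i hi), h3⟩) h
      rw [this]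
      refine I.sum_mem fun T hT => I.sum_mem fun k _ => I.smul_mem _ ?_
      rw [Finset.mem_powersetCard] at hT
      exact H T hT.1 hT.2 k
    obtain ⟨w, hw, hw'⟩ := hfI
    exact ⟨w, hw, hw'⟩
  let mk := I.mkQ
  let s : Finset (F ⧸ I) := (J.powersetCard p ×ˢ (Finset.univ : Finset (Fin 3))).image
    fun x => mk (dlt x.1 (tau x.2))
  have hs : ∀ T ⊆ J, T.card = p → ∀ k, mk (dlt T (tau k)) ∈ s := by
    intro T hT hTp k
    exact Finset.mem_image.2 ⟨(T, k), Finset.mem_product.2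
      ⟨Finset.mem_powersetCard.2 ⟨hT, hTp⟩, Finset.mem_univ _⟩, rfl⟩
  let G := AddSubgroup.closure (s : Set (F ⧸ I))
  let P := dbl G
  have hsG : ∀ x ∈ s, x ∈ G := fun x hx => AddSubgroup.subset_closure hx
  suffices H : ∀ x ∈ s, x ∈ P by
    have h0 := nak s H
    intro T hT hTp k
    have := h0 _ (hs T hT hTp k)
    exact (Submodule.Quotient.mk_eq_zero I).1 this
  intro x hx
  obtain ⟨⟨T, k⟩, hTk, rfl⟩ := Finset.mem_image.1 hx
  have hT := (Finset.mem_powersetCard.1 (Finset.mem_product.1 hTk).1)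
  -- choose the three missing elements
  have hcard : 3 ≤ (J \ T).card := by
    rw [Finset.card_sdiff_of_subset hT.1, card_J, hT.2]; omega
  obtain ⟨C, hC, hC3⟩ := Finset.exists_subset_card_eq hcard
  let X := (J \ T) \ C
  have hdX : (J \ C) \ X = T := by
    ext i
    simp only [X, Finset.mem_sdiff]
    have h1 : i ∈ T → i ∈ J := fun h => hT.1 h
    have h2 : i ∈ C → i ∈ J ∧ i ∉ T := fun h => Finset.mem_sdiff.1 (hC h)
    tauto
  have hXs : X ⊆ J \ C := by
    intro i
    simp only [X, Finset.mem_sdiff]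
    tauto
  let dec : ℕ → Finset (Fin 15) := fun M => J.filter fun i => M.testBit i.val = false
  have hdecJ : ∀ M, dec M ⊆ J := fun M => Finset.filter_subset _ _
  let a : ℕ → F ⧸ I := fun n => if X ⊆ dec (n / 3) ∧ (dec (n / 3) \ X).card = p then
    mk (dlt (dec (n / 3) \ X) (tau ⟨n % 3, Nat.mod_lt _ (by norm_num)⟩)) else 0
  have haG : ∀ n, a n ∈ G := by
    intro n
    simp only [a]
    split_ifs with hc
    · exact hsG _ (hs _ (Finset.sdiff_subset.trans (hdecJ _)) hc.2 _)
    · exact G.zero_mem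
  have h2 : ∀ n, a n + a n ∈ P := fun n => ⟨a n, haG n, rfl⟩
  -- relations
  have hsum : ∀ (M : ℕ) (m : Fin 15), m.val < 12 →
      (∑ k : Fin 3, if pr m k < 12 ∧ M.testBit (pr m k) = false then
        a (3 * (M ||| 2 ^ (pr m k)) + k) else 0) ∈ P := by
    intro M m hm
    set T' := dec M with hT'
    have hterm : ∀ k : Fin 3, (if pr m k < 12 ∧ M.testBit (pr m k) = false then
        a (3 * (M ||| 2 ^ (pr m k)) + k) else 0) =
        ∑ j : Fin 15, if j.val = pr m k ∧ j ∈ T' \ X ∧ X ⊆ T' ∧ (T' \ X).card = p + 1 then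
          mk (dlt ((T' \ X).erase j) (tau k)) else 0 := by
      intro k
      by_cases hc : pr m k < 12 ∧ M.testBit (pr m k) = false
      · rw [if_pos hc, Finset.sum_eq_single ⟨pr m k, by omega⟩]
        · set j : Fin 15 := ⟨pr m k, by omega⟩ with hj
          have hjT : j ∈ T' := Finset.mem_filter.2 ⟨mem_J.2 hc.1, hc.2⟩
          have hn1 : (3 * (M ||| 2 ^ (pr m k)) + k.val) / 3 = M ||| 2 ^ (pr m k) := by omega
          have hn2 : (3 * (M ||| 2 ^ (pr m k)) + k.val) % 3 = k := by omega
          have hd : dec (M ||| 2 ^ (pr m k)) = T'.erase j := by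
            ext i
            simp only [dec, hT', Finset.mem_filter, Finset.mem_erase, Nat.testBit_or,
              Nat.testBit_two_pow, Bool.or_eq_false_iff, decide_eq_false_iff_not]
            have : pr m k = i.val ↔ i = j := ⟨fun h => Fin.ext h.symm, fun h => by rw [h]⟩
            rw [this]; tauto
          simp only [a, hn1, hn2, hd]
          have hXe : (T'.erase j) \ X = (T' \ X).erase j := by
            ext i; simp only [Finset.mem_sdiff, Finset.mem_erase]; tauto
          rw [hXe]
          have hiff : (X ⊆ T'.erase j ∧ ((T' \ X).erase j).card = p) ↔
              (j.val = pr m k ∧ j ∈ T' \ X ∧ X ⊆ T' ∧ (T' \ X).card = p + 1) := by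
            constructor
            · rintro ⟨hX, hcd⟩
              have hjX : j ∈ T' \ X := Finset.mem_sdiff.2
                ⟨hjT, fun h => Finset.notMem_erase j T' (hX h)⟩
              refine ⟨rfl, hjX, hX.trans (Finset.erase_subset _ _), ?_⟩
              rw [← hcd, Finset.card_erase_add_one hjX]
            · rintro ⟨-, hjX, hX, hcd⟩
              refine ⟨fun i hi => Finset.mem_erase.2 ⟨?_, hX hi⟩, ?_⟩
              · rintro rfl; exact (Finset.mem_sdiff.1 hjX).2 hi
              · rw [Finset.card_erase_of_mem hjX, hcd]; rfl
          simp only [hiff]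
        · intro j _ hj
          exact if_neg fun h => hj (Fin.ext h.1)
        · intro h; exact absurd (Finset.mem_univ _) h
      · rw [if_neg hc]
        refine (Finset.sum_eq_zero fun j _ => if_neg ?_).symm
        rintro ⟨h1, h2, -⟩
        have h3 := Finset.mem_filter.1 (Finset.mem_sdiff.1 h2).1
        rw [h1] at h3
        exact hc ⟨by rw [← h1]; exact mem_J.1 h3.1, h3.2⟩
    rw [Finset.sum_congr rfl fun k _ => hterm k]
    by_cases hg : X ⊆ T' ∧ (T' \ X).card = p + 1
    swap
    · rw [Finset.sum_eq_zero]
      · exact P.zero_mem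
      · intro k _
        refine Finset.sum_eq_zero fun j _ => if_neg ?_
        rintro ⟨-, -, h⟩; exact hg h
    set T2 := T' \ X with hT2
    have hT2J : T2 ⊆ J := Finset.sdiff_subset.trans (hdecJ _)
    have hmem : dlt T2 (ev m) ∈ SuppM 3 (p + 1) 4 := Supp_dlt
      ⟨fun i hi => by simpa using mem_J.1 (hT2J hi), Bk_ev m hm, hg.2, by rw [ev_sum]; rfl⟩
    have h0 : mk (dK 3 (dlt T2 (ev m))) = 0 :=
      (Submodule.Quotient.mk_eq_zero I).2 (Submodule.mem_map_of_mem hmem)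
    rw [dK_dlt, map_sum] at h0
    rw [Finset.sum_comm]
    have hsubm : ∀ {A B : F ⧸ I}, B = 0 → A - B ∈ P → A ∈ P := by
      intro A B hB h; rwa [hB, sub_zero] at h
    refine hsubm h0 ?_
    rw [← Finset.sum_sub_distrib]
    refine P.sum_mem fun j _ => ?_
    by_cases hj : j ∈ T2
    swap
    · rw [if_neg (fun h => hj h.1), map_zero, sub_zero, Finset.sum_eq_zero]
      · exact P.zero_mem
      · intro k _; exact if_neg (by rintro ⟨-, h, -⟩; exact hj h)
    have hj12 := mem_J.1 (hT2J hj)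
    have he : T2.erase j ⊆ J := (Finset.erase_subset _ _).trans hT2J
    have hec : (T2.erase j).card = p := by rw [Finset.card_erase_of_mem hj, hg.2]; rfl
    by_cases hB : Bk 3 (ev m + ev j)
    · obtain ⟨k, hk⟩ := (Bk_iff m j hm hj12).1 hB
      rw [if_pos ⟨hj, hB⟩, Finset.sum_eq_single k, if_pos ⟨(pr_iff m j k hm hj12).2 hk, hj, hg⟩,
        hk, map_smul]
      · have hxG := hsG _ (hs _ he hec k)
        rcases sg_cases j (T2.erase j) with h | h <;> rw [h]
        · rw [one_smul, sub_self]; exact P.zero_mem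
        · rw [neg_one_smul, sub_neg_eq_add]; exact ⟨_, hxG, rfl⟩
      · intro k' _ hk'
        refine if_neg ?_
        rintro ⟨h, -⟩
        exact hk' (tau_inj _ _ (((pr_iff m j k' hm hj12).1 h).symm.trans hk))
      · intro h; exact absurd (Finset.mem_univ _) h
    · rw [if_neg (fun h => hB h.2), map_zero, sub_zero, Finset.sum_eq_zero]
      · exact P.zero_mem
      · intro k _
        refine if_neg ?_
        rintro ⟨h, -⟩
        exact hB ((Bk_iff m j hm hj12).2 ⟨k, (pr_iff m j k hm hj12).1 h⟩)
  have hMlt : ∀ M < 2 ^ 12, ∀ c < 12, M ||| 2 ^ c < 2 ^ 12 := fun M hM c hc =>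
    Nat.or_lt_two_pow hM (Nat.pow_lt_pow_right (by norm_num) hc)
  have htermv : ∀ M < 2 ^ 12, ∀ (m : Fin 15) (k : Fin 3), mval 12288 a (termB M m k) =
      if pr m k < 12 ∧ M.testBit (pr m k) = false then
        a (3 * (M ||| 2 ^ (pr m k)) + k) else 0 := by
    intro M hM m k
    unfold termB
    by_cases hc : pr m k < 12 ∧ M.testBit (pr m k) = false
    · rw [if_pos hc]
      have : (Nat.blt (pr m k) 12 && !(M.testBit (pr m k))) = true := by
        have hb : Nat.blt (pr m k) 12 = true := by rw [Nat.blt_eq]; exact hc.1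
        rw [hc.2, hb]; rfl
      rw [this, cond_true, mval_pow]
      have := hMlt M hM _ hc.1
      omega
    · rw [if_neg hc]
      have : (Nat.blt (pr m k) 12 && !(M.testBit (pr m k))) = false := by
        rw [Bool.eq_false_iff]
        intro h
        rw [Bool.and_eq_true, Nat.blt_eq, Bool.not_eq_true'] at h
        exact hc h
      rw [this, cond_false, mval_zero]
  have hrel : ∀ i, mval 12288 a (relB i) ∈ P := by
    intro i
    unfold relB
    have hM : 2 ^ (i / 144 % 12) ||| 2 ^ (i / 12 % 12) < 2 ^ 12 :=
      hMlt _ (Nat.pow_lt_pow_right (by norm_num) (Nat.mod_lt _ (by norm_num))) _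
        (Nat.mod_lt _ (by norm_num))
    generalize 2 ^ (i / 144 % 12) ||| 2 ^ (i / 12 % 12) = M at hM
    have hm : i % 12 < 12 := Nat.mod_lt _ (by norm_num)
    have hs3 := hsum M ⟨i % 12, by omega⟩ hm
    rw [Fin.sum_univ_three] at hs3
    rw [← htermv M hM, ← htermv M hM, ← htermv M hM] at hs3
    unfold relM
    have e1 := mval_xor P 12288 a h2 (r := termB M (i % 12) 0)
      (s := termB M (i % 12) 1 ^^^ termB M (i % 12) 2)
    have e2 := mval_xor P 12288 a h2 (r := termB M (i % 12) 1) (s := termB M (i % 12) 2)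
    have := P.add_mem (P.add_mem e1 e2) hs3
    convert this using 1
    simp only [Fin.val_zero, Fin.val_one, Fin.val_two]
    abel
  have hfin := run_sound P 12288 a h2 relB hrel certB 0 (by simp)
  have hck := checkB
  rw [frc_eq] at hck
  obtain ⟨c1, c2, c3, h12, h13, h23, hCeq⟩ := Finset.card_eq_three.1 hC3
  have hCJ : ∀ c ∈ C, c.val < 12 := fun c hc => mem_J.1 (Finset.mem_sdiff.1 (hC hc)).1
  have hc1 := hCJ c1 (by simp [hCeq])
  have hc2 := hCJ c2 (by simp [hCeq])
  have hc3 := hCJ c3 (by simp [hCeq])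
  unfold finalB at hck
  simp only [List.all_eq_true, List.mem_range] at hck
  have hb := hck _ hc1 _ hc2 _ hc3 k.val k.isLt
  have nb : ∀ {x y : Fin 15}, x ≠ y → Nat.beq x.val y.val = false := by
    intro x y hxy
    rw [Bool.eq_false_iff]
    intro h
    exact hxy (Fin.ext (Nat.eq_of_beq_eq_true h))
  rw [nb h12, nb h13, nb h23] at hb
  simp only [Bool.false_or] at hb
  set M := 2 ^ c1.val ||| 2 ^ c2.val ||| 2 ^ c3.val with hMdef
  have hM : M < 2 ^ 12 :=
    hMlt _ (hMlt _ (Nat.pow_lt_pow_right (by norm_num) hc1) _ hc2) _ hc3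
  have hres := hfin (3 * M + k.val) (by omega) hb
  have hn1 : (3 * M + k.val) / 3 = M := by omega
  have hn2 : (3 * M + k.val) % 3 = k := by omega
  have hd : dec M = J \ C := by
    ext i
    simp only [dec, hMdef, hCeq, Finset.mem_filter, Finset.mem_sdiff, Nat.testBit_or,
      Nat.testBit_two_pow, Bool.or_eq_false_iff, decide_eq_false_iff_not, Finset.mem_insert,
      Finset.mem_singleton, not_or, Fin.ext_iff, and_assoc]
    rw [@eq_comm _ c1.val, @eq_comm _ c2.val, @eq_comm _ c3.val]
  simp only [a, hn1, hn2, hd, hdX] at hres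
  rw [if_pos ⟨hXs, hT.2⟩] at hres
  exact hres

end VB

set_option maxHeartbeats 400000
namespace VB

lemma eq_ev {t : Fin 3 → ℕ} (hB : Bk 3 t) (ht : ∑ i, t i = 4) :
    ∃ m : Fin 15, m.val < 12 ∧ t = ev m := by
  have h0 := hB 0 (by decide)
  have h1 := hB 1 (by decide)
  have h2 := hB 2 (by decide)
  rw [Fin.sum_univ_three] at ht
  have key : ∀ a b c : Fin 4, a.val + b.val + c.val = 4 →
      ∃ m : Fin 15, m.val < 12 ∧ ![a.val, b.val, c.val] = ev m := by decide +kernel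
  obtain ⟨m, hm, h⟩ := key ⟨t 0, by omega⟩ ⟨t 1, by omega⟩ ⟨t 2, by omega⟩ ht
  refine ⟨m, hm, ?_⟩
  rw [← h]
  funext i; fin_cases i <;> rfl

lemma pr_exists : ∀ m : Fin 15, m.val < 12 → ∃ (k : Fin 3) (j : Fin 15), j.val < 12 ∧
    ev j ≤ tau k ∧ tau k - ev j = ev m := by decide +kernel

/-- reduction modulo 12 -/
def nf (n : ℕ) : Fin 15 := ⟨n % 12, by have := Nat.mod_lt n (by norm_num : 0 < 12); omega⟩

lemma nf_lt (n : ℕ) : (nf n).val < 12 := Nat.mod_lt _ (by norm_num)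

lemma pr_le : ∀ (j : Fin 15) (k : Fin 3), j.val < 12 → (ev j ≤ tau k ↔ pr j k < 12) := by
  decide +kernel

lemma pr_sub : ∀ (j : Fin 15) (k : Fin 3), j.val < 12 → pr j k < 12 →
    tau k - ev j = ev (nf (pr j k)) := by
  decide +kernel

lemma Supp_J {p e f T t} (hf : Supp 3 p e f) {i : Fin 15} (hi : i ∈ T) (h : ¬ i.val < 12) :
    f T t = 0 := by
  by_contra h0
  exact h (by simpa using (hf _ _ h0).1 i hi)

lemma exD : Ex 3 12 4 := by
  intro f hf hdf
  refine ⟨0, Supp_zero _ _ _, ?_⟩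
  rw [map_zero]
  ext T t
  by_contra h0
  have hne : f T t ≠ 0 := Ne.symm h0
  obtain ⟨h1, h2, h3, h4⟩ := hf T t hne
  have hT : T = J := Finset.eq_of_subset_of_card_le
    (fun i hi => mem_J.2 (by simpa using h1 i hi)) (by rw [h3, card_J])
  subst hT
  obtain ⟨m, hm, rfl⟩ := eq_ev h2 (by exact_mod_cast h4)
  obtain ⟨k, j, hj, hle, hsub⟩ := pr_exists m hm
  have := congrFun (congrFun hdf (J.erase j)) (tau k)
  rw [dK_apply, if_pos (Bk_tau k), Finset.sum_eq_single j] at this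
  · rw [if_pos ⟨Finset.notMem_erase _ _, hle⟩, Finset.insert_erase (mem_J.2 hj), hsub] at this
    exact hne ((mul_eq_zero.1 this).resolve_left (sg_ne _ _))
  · intro i _ hi
    split_ifs with hc
    · rw [Supp_J hf (Finset.mem_insert_self i _), mul_zero]
      intro h
      exact hc.1 (Finset.mem_erase.2 ⟨hi, mem_J.2 h⟩)
    · rfl
  · intro h; exact absurd (Finset.mem_univ _) h

lemma exC_aux {f : F} (hf : Supp 3 11 4 f) (hdf : dK 3 f = 0) (h00 : f (J.erase 0) (ev 0) = 0) :
    f = 0 := by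
  classical
  let a : ℕ → ℂ := fun n => f (J.erase (nf (n / 12))) (ev (nf n))
  let s : Finset ℂ := (Finset.range 144).image a
  have has : ∀ n, n < 144 → a n ∈ s := fun n hn => Finset.mem_image_of_mem _ (Finset.mem_range.2 hn)
  have hamod : ∀ n, a n = a (n % 144) := by
    intro n
    have e1 : nf (n / 12) = nf (n % 144 / 12) := Fin.ext (by simp only [nf]; omega)
    have e2 : nf n = nf (n % 144) := Fin.ext (by simp only [nf]; omega)
    simp only [a, ← e1, ← e2]
  let G := AddSubgroup.closure (s : Set ℂ)
  have haG : ∀ n, a n ∈ G := fun n => by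
    rw [hamod]; exact AddSubgroup.subset_closure (has _ (Nat.mod_lt _ (by norm_num)))
  let P := dbl G
  have h2 : ∀ n, a n + a n ∈ P := fun n => ⟨a n, haG n, rfl⟩
  have hX : ∀ (j j' k : ℕ), j < 12 → j' < 12 → k < 3 →
      mval 144 a (cond (Nat.blt (pr j k) 12) (2 ^ (12 * j' + pr j k)) 0) =
      if pr j k < 12 then a (12 * j' + pr j k) else 0 := by
    intro j j' k hj hj' hk
    by_cases h : pr j k < 12
    · have hb : Nat.blt (pr j k) 12 = true := by rw [Nat.blt_eq]; exact h
      rw [if_pos h, hb, cond_true, mval_pow]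
      omega
    · have hb : Nat.blt (pr j k) 12 = false := by
        rw [Bool.eq_false_iff, Ne, Nat.blt_eq]; exact h
      rw [if_neg h, hb, cond_false, mval_zero]
  have hrel : ∀ i, mval 144 a (relC i) ∈ P := by
    intro i
    unfold relC
    have hj : i / 36 % 12 < 12 := Nat.mod_lt _ (by norm_num)
    have hj' : i / 3 % 12 < 12 := Nat.mod_lt _ (by norm_num)
    have hk : i % 3 < 3 := Nat.mod_lt _ (by norm_num)
    generalize i / 36 % 12 = j at hj
    generalize i / 3 % 12 = j' at hj'
    generalize i % 3 = k at hk
    unfold relC'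
    by_cases hjj : j = j'
    · have : Nat.beq j j' = true := by rw [Nat.beq_eq]; exact hjj
      rw [this, cond_true, mval_zero]; exact P.zero_mem
    have hb : Nat.beq j j' = false := by
      rw [Bool.eq_false_iff, Ne, Nat.beq_eq]; exact hjj
    rw [hb, cond_false]
    have e1 := mval_xor P 144 a h2 (r := cond (Nat.blt (pr j k) 12) (2 ^ (12 * j' + pr j k)) 0)
      (s := cond (Nat.blt (pr j' k) 12) (2 ^ (12 * j + pr j' k)) 0)
    rw [hX j j' k hj hj' hk, hX j' j k hj' hj hk] at e1
    have e2 := P.add_mem e1 (y := (if pr j k < 12 then a (12 * j' + pr j k) else 0) +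
      (if pr j' k < 12 then a (12 * j + pr j' k) else 0)) ?_
    · simpa using e2
    let u : Fin 15 := ⟨j, by omega⟩
    let v : Fin 15 := ⟨j', by omega⟩
    let kk : Fin 3 := ⟨k, hk⟩
    have huv : u ≠ v := fun h => hjj (congrArg Fin.val h)
    have h := congrFun (congrFun hdf ((J.erase u).erase v)) (tau kk)
    rw [dK_apply, if_pos (Bk_tau kk), Finset.sum_eq_add u v huv] at h
    · have hval : ∀ (x y : Fin 15), x.val < 12 → y.val < 12 → x ≠ y →
          (if x ∉ (J.erase u).erase v ∧ ev x ≤ tau kk then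
          sg x ((J.erase u).erase v) * f (J.erase y) (tau kk - ev x) else 0) =
          sg x ((J.erase u).erase v) *
          (if x ∉ (J.erase u).erase v ∧ pr x kk < 12 then a (12 * y.val + pr x kk) else 0) := by
        intro x y hx hy hxy
        by_cases hc : x ∉ (J.erase u).erase v ∧ ev x ≤ tau kk
        · have hc2 := (pr_le x kk hx).1 hc.2
          rw [if_pos hc, if_pos ⟨hc.1, hc2⟩, pr_sub x kk hx hc2]
          have e3 : nf ((12 * y.val + pr x kk) / 12) = y := Fin.ext (by simp only [nf]; omega)
          have e4 : nf (12 * y.val + pr x kk) = nf (pr x kk) := Fin.ext (by simp only [nf]; omega)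
          simp only [a, e3, e4]
        · rw [if_neg hc, if_neg, mul_zero]
          rw [pr_le x kk hx] at hc
          exact hc
      have i1 : insert u ((J.erase u).erase v) = J.erase v := by
        rw [Finset.erase_right_comm, Finset.insert_erase]
        exact Finset.mem_erase.2 ⟨huv, mem_J.2 hj⟩
      have i2 : insert v ((J.erase u).erase v) = J.erase u := by
        rw [Finset.insert_erase]
        exact Finset.mem_erase.2 ⟨huv.symm, mem_J.2 hj'⟩
      rw [i1, i2, hval u v hj hj' huv, hval v u hj' hj huv.symm] at h
      have n1 : u ∉ (J.erase u).erase v := by simp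
      have n2 : v ∉ (J.erase u).erase v := by simp
      simp only [n1, n2, not_false_eq_true, true_and] at h
      change _ * (if pr j k < 12 then a (12 * j' + pr j k) else 0) +
        _ * (if pr j' k < 12 then a (12 * j + pr j' k) else 0) = 0 at h
      have g1 : (if pr j k < 12 then a (12 * j' + pr j k) else 0) ∈ G := by
        split_ifs; exacts [haG _, G.zero_mem]
      generalize (if pr j k < 12 then a (12 * j' + pr j k) else 0) = A at h g1 ⊢
      generalize (if pr j' k < 12 then a (12 * j + pr j' k) else 0) = B at h ⊢
      rcases sg_cases u ((J.erase u).erase v) with s1 | s1 <;>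
      rcases sg_cases v ((J.erase u).erase v) with s2 | s2 <;> rw [s1, s2] at h
      · exact ⟨0, G.zero_mem, by linear_combination h⟩
      · exact ⟨A, g1, by linear_combination -h⟩
      · exact ⟨A, g1, by linear_combination h⟩
      · exact ⟨0, G.zero_mem, by linear_combination -h⟩
    · rintro i - ⟨hi1, hi2⟩
      split_ifs with hc
      · rw [Supp_J hf (Finset.mem_insert_self i _), mul_zero]
        intro h
        exact hc.1 (Finset.mem_erase.2 ⟨hi2, Finset.mem_erase.2 ⟨hi1, mem_J.2 h⟩⟩)
      · rfl
    · intro h; exact absurd (Finset.mem_univ _) h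
    · intro h; exact absurd (Finset.mem_univ _) h
  have hfin := run_sound P 144 a h2 relC hrel certC 1 (by
    intro x hx hb
    have : x = 0 := by
      by_contra h
      rw [Nat.testBit_one_eq_true_iff_self_eq_zero] at hb
      exact h hb
    subst this
    have : a 0 = 0 := h00
    rw [this]; exact P.zero_mem)
  rw [checkC] at hfin
  have h0 := nak s (by
    intro x hx
    obtain ⟨n, hn, rfl⟩ := Finset.mem_image.1 hx
    have hn' := Finset.mem_range.1 hn
    exact hfin n hn' (by rw [Nat.testBit_two_pow_sub_one]; simpa using hn'))
  ext T t
  by_contra hne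
  obtain ⟨h1, h2, h3, h4⟩ := hf T t hne
  have hTJ : T ⊆ J := fun i hi => mem_J.2 (by simpa using h1 i hi)
  have hc : (J \ T).card = 1 := by rw [Finset.card_sdiff_of_subset hTJ, h3, card_J]
  obtain ⟨j, hj⟩ := Finset.card_eq_one.1 hc
  have hjJ : j ∈ J \ T := by rw [hj]; exact Finset.mem_singleton_self _
  have hT : T = J.erase j := by
    rw [← Finset.sdiff_singleton_eq_erase, ← hj, Finset.sdiff_sdiff_eq_self hTJ]
  obtain ⟨m, hm, rfl⟩ := eq_ev h2 (by exact_mod_cast h4)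
  have hj12 := mem_J.1 (Finset.mem_sdiff.1 hjJ).1
  have := h0 (a (12 * j.val + m.val)) (has _ (by omega))
  have e3 : nf ((12 * j.val + m.val) / 12) = j := Fin.ext (by simp only [nf]; omega)
  have e4 : nf (12 * j.val + m.val) = m := Fin.ext (by simp only [nf]; omega)
  simp only [a, e3, e4, ← hT] at this
  exact hne this

lemma exC : Ex 3 11 4 := by
  intro f hf hdf
  have hc : Cell 3 12 (4 - 4) J 0 :=
    ⟨fun i hi => by simpa using mem_J.1 hi, fun i _ => by simp, card_J, by simp⟩
  have hS := Supp_dlt hc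
  have hv : dK 3 (dlt J 0) (J.erase 0) (ev 0) = sg 0 (J.erase 0) := by
    rw [dK_apply, if_pos (Bk_ev 0 (by decide)), Finset.sum_eq_single 0]
    · rw [if_pos ⟨Finset.notMem_erase _ _, le_rfl⟩, Finset.insert_erase (by decide), tsub_self]
      simp [dlt]
    · intro i _ hi
      exact if_neg (fun h => hi (ev_le _ _ h.2))
    · intro h; exact absurd (Finset.mem_univ _) h
  set c : ℂ := sg 0 (J.erase 0) * f (J.erase 0) (ev 0)
  have hS' : Supp 3 12 (4 - 4) (c • dlt J 0) := (SuppM 3 12 (4 - 4)).smul_mem c hS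
  refine ⟨c • dlt J 0, hS', ?_⟩
  have := exC_aux (f := f - dK 3 (c • dlt J 0)) (hf.sub hS'.dK)
    (by rw [map_sub, hdf, dK_dK, sub_zero]) (by
      rw [Pi.sub_apply, Pi.sub_apply, map_smul, Pi.smul_apply, Pi.smul_apply, hv, smul_eq_mul]
      have := sg_sq 0 (J.erase 0)
      simp only [c]
      linear_combination -(f (J.erase 0) (ev 0)) * this)
  exact (sub_eq_zero.1 this).symm

/-- all the vanishing needed -/
lemma Ex_all (p : ℕ) (q : ℤ) (h : q < 0 ∨ (q = 0 ∧ 0 < p) ∨ (q = 1 ∧ 11 ≤ p) ∨ (q = 2 ∧ p ≤ 9) ∨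
    3 ≤ q ∨ 13 ≤ p) : Ex 0 p (4 * q) := by
  apply Ex_of_three
  by_cases h13 : 13 ≤ p
  · exact Ex3_p h13
  rcases h with h | ⟨rfl, h⟩ | ⟨rfl, h⟩ | ⟨rfl, h⟩ | h | h
  · exact Ex3_neg (by omega)
  · exact Ex3_zero h
  · have : p = 11 ∨ p = 12 := by omega
    rcases this with rfl | rfl
    · exact exC
    · exact exD
  · exact exB h
  · exact Ex3_large (by omega)
  · exact absurd h h13

end VB

set_option maxHeartbeats 400000
open scoped TensorProduct
namespace VB

/-- index type of monomials of degree `e` -/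
abbrev Ix (e : ℤ) : Type := {t : Fin 3 → ℕ // ((∑ i, t i : ℕ) : ℤ) = e}

/-- the finitely supported exponent -/
noncomputable def fs (t : Fin 3 → ℕ) : Fin 3 →₀ ℕ := Finsupp.equivFunOnFinite.symm t

lemma fs_inj : Function.Injective fs := Finsupp.equivFunOnFinite.symm.injective

lemma fs_add (t s : Fin 3 → ℕ) : fs (t + s) = fs t + fs s := by ext i; rfl

lemma fs_degree (t : Fin 3 → ℕ) : (fs t).degree = ∑ i, t i := by
  rw [Finsupp.degree_eq_sum]; rfl

/-- monomials -/
noncomputable def mo (t : Fin 3 → ℕ) : PolyC 3 := MvPolynomial.monomial (fs t) 1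

lemma mo_mul (t s) : mo t * mo s = mo (t + s) := by
  simp [mo, MvPolynomial.monomial_mul, fs_add]

lemma mo_li (e : ℤ) : LinearIndependent ℂ (fun t : Ix e => mo t.1) := by
  have := (MvPolynomial.basisMonomials (Fin 3) ℂ).linearIndependent.comp
    (fun t : Ix e => fs t.1) (fun a b h => Subtype.ext (fs_inj h))
  simpa [Function.comp_def, mo] using this

lemma span_mo (e : ℤ) : Submodule.span ℂ (Set.range (fun t : Ix e => mo t.1)) = Sdeg 3 e := by
  unfold Sdeg
  split_ifs with he
  · apply le_antisymm
    · rw [Submodule.span_le]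
      rintro _ ⟨t, rfl⟩
      have ht := t.2
      exact MvPolynomial.isHomogeneous_monomial _ (by rw [fs_degree]; omega)
    · intro x hx
      rw [← MvPolynomial.support_sum_monomial_coeff x]
      refine Submodule.sum_mem _ fun σ hσ => ?_
      have hd : σ.degree = e.toNat := by
        have := (MvPolynomial.mem_homogeneousSubmodule _ _).1 hx (MvPolynomial.mem_support_iff.1 hσ)
        rwa [Finsupp.degree_eq_weight_one]
      have e1 : MvPolynomial.monomial σ (MvPolynomial.coeff σ x) =
          MvPolynomial.coeff σ x • mo σ := by
        rw [mo, MvPolynomial.smul_monomial, smul_eq_mul, mul_one,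
          show fs σ = σ from Finsupp.equivFunOnFinite.symm_apply_apply σ]
      rw [e1]
      refine Submodule.smul_mem _ _ (Submodule.subset_span ⟨⟨σ, ?_⟩, rfl⟩)
      rw [Finsupp.degree_eq_sum] at hd
      omega
  · rw [Submodule.span_eq_bot]
    rintro _ ⟨t, rfl⟩
    have := t.2
    omega

/-- monomial basis -/
noncomputable def bS (e : ℤ) : Module.Basis (Ix e) ℂ (Sdeg 3 e) :=
  (Module.Basis.span (mo_li e)).map (LinearEquiv.ofEq _ _ (span_mo e))

lemma bS_coe (e : ℤ) (t : Ix e) : ((bS e t : Sdeg 3 e) : PolyC 3) = mo t.1 := by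
  rw [bS, Module.Basis.map_apply, LinearEquiv.coe_ofEq_apply, Module.Basis.span_apply]

instance finIx (e : ℤ) : Finite (Ix e) := by
  refine Finite.of_injective (β := Fin 3 → Fin (e.toNat + 1))
    (fun t i => ⟨t.1 i, ?_⟩) ?_
  · have h1 := t.2
    have h2 := Finset.single_le_sum (f := t.1) (fun _ _ => Nat.zero_le _) (Finset.mem_univ i)
    omega
  · intro a b h
    ext i
    exact congrArg Fin.val (congrFun h i)

lemma ev_inj : Function.Injective ev := fun i j h => ev_le j i h.le

lemma ev_surj {t : Fin 3 → ℕ} (ht : ((∑ i, t i : ℕ) : ℤ) = 4) : ∃ m, ev m = t := by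
  have ht : ∑ i, t i = 4 := by exact_mod_cast ht
  rw [Fin.sum_univ_three] at ht
  have key : ∀ a b c : Fin 5, a.val + b.val + c.val = 4 →
      ∃ m : Fin 15, ev m = ![a.val, b.val, c.val] := by decide +kernel
  obtain ⟨m, h⟩ := key ⟨t 0, by omega⟩ ⟨t 1, by omega⟩ ⟨t 2, by omega⟩ ht
  refine ⟨m, h.trans ?_⟩
  funext i; fin_cases i <;> rfl

/-- the quartic monomials -/
noncomputable def eqv : Fin 15 ≃ Ix 4 :=
  Equiv.ofBijective (fun i => ⟨ev i, by rw [ev_sum]; rfl⟩)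
    ⟨fun i j h => ev_inj (congrArg Subtype.val h),
      fun t => (ev_surj t.2).imp fun m hm => Subtype.ext hm⟩

noncomputable def bU : Module.Basis (Fin 15) ℂ (Sdeg 3 4) := (bS 4).reindex eqv.symm

lemma bU_coe (i : Fin 15) : ((bU i : Sdeg 3 4) : PolyC 3) = mo (ev i) := by
  rw [bU, Module.Basis.reindex_apply, Equiv.symm_symm, bS_coe]; rfl

/-- basis of a Koszul term -/
noncomputable def bT (p : ℕ) (e : ℤ) :
    Module.Basis (Set.powersetCard (Fin 15) p × Ix e) ℂ (KosModule 3 4 p e) :=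
  (bU.exteriorPower p).tensorProduct (bS e)

lemma T_card {p : ℕ} (T : Set.powersetCard (Fin 15) p) : T.1.card = p := T.2

/-- increasing enumeration -/
def emb {p : ℕ} (T : Set.powersetCard (Fin 15) p) : Fin p ↪o Fin 15 :=
  T.1.orderEmbOfFin (T_card T)

lemma emb_mem {p : ℕ} (T : Set.powersetCard (Fin 15) p) (i) : emb T i ∈ T.1 :=
  Finset.orderEmbOfFin_mem _ _ _

lemma emb_range {p : ℕ} (T : Set.powersetCard (Fin 15) p) : Set.range (emb T) = T.1 :=
  Finset.range_orderEmbOfFin _ _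

/-- the differential, with its type spelled out -/
def DD (D : KFam 3 4) (p : ℕ) (e e' : ℤ) : KosModule 3 4 (p + 1) e →ₗ[ℂ] KosModule 3 4 p e' :=
  D p e e'

lemma bT_apply (p e) (T : Set.powersetCard (Fin 15) p) (t : Ix e) :
    bT p e (T, t) = wedgeE ℂ (Sdeg 3 4) p (fun i => bU (emb T i)) ⊗ₜ bS e t := by
  rw [bT, Module.Basis.tensorProduct_apply, exteriorPower.basis_apply]; rfl

instance : Finite (Ix 4) := finIx 4

/-- coordinates -/
noncomputable def Phi (p : ℕ) (e : ℤ) : KosModule 3 4 p e →ₗ[ℂ] F where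
  toFun z T t := if h : T.card = p ∧ ((∑ i, t i : ℕ) : ℤ) = e then
    (bT p e).repr z (⟨T, h.1⟩, ⟨t, h.2⟩) else 0
  map_add' x y := by
    ext T t
    simp only [Pi.add_apply]
    split_ifs <;> simp
  map_smul' c x := by
    ext T t
    simp only [Pi.smul_apply]
    split_ifs <;> simp

lemma Phi_apply (p e z T t) : Phi p e z T t = if h : T.card = p ∧ ((∑ i, t i : ℕ) : ℤ) = e then
    (bT p e).repr z (⟨T, h.1⟩, ⟨t, h.2⟩) else 0 := rfl

lemma Phi_inj (p e) : Function.Injective (Phi p e) := by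
  intro x y h
  apply (bT p e).repr.injective
  ext ⟨T, t⟩
  have := congrFun (congrFun h T.1) t.1
  rw [Phi_apply, Phi_apply, dif_pos ⟨T.2, t.2⟩, dif_pos ⟨T.2, t.2⟩] at this
  exact this

lemma Phi_supp (p e z) : Supp 0 p e (Phi p e z) := by
  intro T t h
  rw [Phi_apply] at h
  split_ifs at h with hc
  · exact ⟨fun i _ => i.2, fun i hi => absurd hi (Nat.not_lt_zero _), hc⟩
  · exact absurd rfl h

lemma Phi_surj {p e w} (hw : Supp 0 p e w) : ∃ z, Phi p e z = w := by
  refine ⟨(bT p e).repr.symm (Finsupp.equivFunOnFinite.symm fun x => w x.1.1 x.2.1), ?_⟩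
  ext T t
  rw [Phi_apply]
  split_ifs with hc
  · simp
  · by_contra h
    exact hc (hw T t (Ne.symm h)).2.2

lemma Phi_bT (p e) (T : Set.powersetCard (Fin 15) p) (t : Ix e) :
    Phi p e (bT p e (T, t)) = dlt T.1 t.1 := by
  ext S s
  rw [Phi_apply]
  simp only [dlt]
  split_ifs with h1 h2 h2
  · rw [Module.Basis.repr_self, Finsupp.single_apply, if_pos]
    exact Prod.ext (Subtype.ext h2.1.symm) (Subtype.ext h2.2.symm)
  · rw [Module.Basis.repr_self, Finsupp.single_apply, if_neg]
    intro h
    exact h2 ⟨(congrArg (fun x => x.1.1) h).symm, (congrArg (fun x => x.2.1) h).symm⟩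
  · exact absurd ⟨h2.1 ▸ T.2, h2.2 ▸ t.2⟩ h1
  · rfl

lemma incl_inj (p : ℕ) (e : ℤ) : Function.Injective (TensorProduct.map
    (LinearMap.id (R := ℂ) (M := ↥(⋀[ℂ]^p ↥(Sdeg 3 4)))) (Sdeg 3 e).subtype) :=
  Module.Flat.lTensor_preserves_injective_linearMap _ (Submodule.subtype_injective _)

end VB

set_option maxHeartbeats 400000
open scoped TensorProduct
namespace VB

variable {D : KFam 3 4}

lemma card_eraseK {p : ℕ} (T : Set.powersetCard (Fin 15) (p + 1)) (k : Fin (p + 1)) :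
    (T.1.erase (emb T k)).card = p := by
  rw [Finset.card_erase_of_mem (emb_mem _ _), T_card]; rfl

/-- remove the `k`-th element -/
def eraseK {p : ℕ} (T : Set.powersetCard (Fin 15) (p + 1)) (k : Fin (p + 1)) :
    Set.powersetCard (Fin 15) p :=
  ⟨T.1.erase (emb T k), card_eraseK T k⟩

lemma emb_eraseK {p : ℕ} (T : Set.powersetCard (Fin 15) (p + 1)) (k : Fin (p + 1)) (i : Fin p) :
    emb (eraseK T k) i = emb T (Fin.succAbove k i) := by
  refine (congrFun (Finset.orderEmbOfFin_unique (T_card (eraseK T k))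
    (f := fun i => emb T (Fin.succAbove k i)) ?_ ?_) i).symm
  · intro x
    refine Finset.mem_erase.2 ⟨?_, emb_mem _ _⟩
    intro h
    exact Fin.succAbove_ne k x ((emb T).injective h)
  · intro x y h
    exact (emb T).strictMono (Fin.strictMono_succAbove k h)

lemma sg_eraseK {p : ℕ} (T : Set.powersetCard (Fin 15) (p + 1)) (k : Fin (p + 1)) :
    sg (emb T k) (eraseK T k).1 = (-1) ^ k.val := by
  unfold sg
  congr 1
  have : (eraseK T k).1.filter (· < emb T k) =
      (Finset.univ.filter (· < k)).map (emb T).toEmbedding := by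
    ext i
    simp only [eraseK, Finset.mem_filter, Finset.mem_erase, Finset.mem_map, Finset.mem_univ,
      true_and]
    constructor
    · rintro ⟨⟨h1, h2⟩, h3⟩
      have : i ∈ Set.range (emb T) := by
        rw [emb_range]; exact h2
      obtain ⟨a, rfl⟩ := this
      exact ⟨a, (emb T).lt_iff_lt.1 h3, rfl⟩
    · rintro ⟨a, ha, rfl⟩
      have h := (emb T).lt_iff_lt.2 ha
      exact ⟨⟨h.ne, emb_mem _ _⟩, h⟩
  have h : Finset.univ.filter (· < k) = Finset.Iio k := by ext; simp
  rw [this, Finset.card_map, h, Fin.card_Iio]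

/-- add an exponent -/
def addK {e e' : ℤ} (he : e' = e + 4) (t : Ix e) (i : Fin 15) : Ix e' :=
  ⟨t.1 + ev i, by rw [sum_add_ev]; have := t.2; push_cast at this ⊢; omega⟩

lemma D_basis (hD : IsKoszulFam 3 4 D) (p : ℕ) (e e' : ℤ) (he : e' = e + 4)
    (T : Set.powersetCard (Fin 15) (p + 1)) (t : Ix e) :
    DD D p e e' (bT (p + 1) e (T, t)) = ∑ k : Fin (p + 1), ((-1 : ℂ) ^ (k.val + 1)) •
      bT p e' (eraseK T k, addK he t (emb T k)) := by
  apply incl_inj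
  rw [bT_apply, map_sum]
  refine (hD p e e' he _ _).trans ?_
  refine Finset.sum_congr rfl fun k _ => ?_
  rw [map_smul, bT_apply, TensorProduct.map_tmul]
  congr 2
  · simp only [emb_eraseK]; rfl
  · rw [bS_coe, bU_coe, mo_mul, Submodule.subtype_apply, bS_coe, add_comm]; rfl

lemma dK_Phi (hD : IsKoszulFam 3 4 D) (p : ℕ) (e e' : ℤ) (he : e' = e + 4)
    (z : KosModule 3 4 (p + 1) e) :
    dK 0 (Phi (p + 1) e z) = - Phi p e' (DD D p e e' z) := by
  suffices h : (dK 0).comp (Phi (p + 1) e) = - (Phi p e').comp (DD D p e e') from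
    LinearMap.congr_fun h z
  refine (bT (p + 1) e).ext ?_
  rintro ⟨T, t⟩
  rw [LinearMap.comp_apply, LinearMap.neg_apply, LinearMap.comp_apply, D_basis hD p e e' he,
    Phi_bT, dK_dlt, map_sum, ← Finset.sum_neg_distrib]
  have e1 : ∀ j : Fin 15, (if j ∈ T.1 ∧ Bk 0 (t.1 + ev j) then
      sg j (T.1.erase j) • dlt (T.1.erase j) (t.1 + ev j) else 0) =
      if j ∈ T.1 then sg j (T.1.erase j) • dlt (T.1.erase j) (t.1 + ev j) else 0 := by
    intro j
    have : Bk 0 (t.1 + ev j) := fun i hi => absurd hi (Nat.not_lt_zero _)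
    simp [this]
  rw [Finset.sum_congr rfl fun j _ => e1 j, ← Finset.sum_filter]
  have e2 : Finset.univ.filter (· ∈ T.1) =
      (Finset.univ : Finset (Fin (p + 1))).map (emb T).toEmbedding := by
    ext i
    have : i ∈ T.1 ↔ i ∈ Set.range (emb T) := by rw [emb_range, Finset.mem_coe]
    rw [Finset.mem_filter, Finset.mem_map, this]
    simp
  rw [e2, Finset.sum_map]
  refine Finset.sum_congr rfl fun k _ => ?_
  rw [map_smul, Phi_bT]
  have := sg_eraseK T k
  simp only [eraseK] at this ⊢
  simp only [RelEmbedding.coe_toEmbedding]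
  rw [this, pow_succ, mul_neg_one, neg_smul, neg_neg]
  rfl

lemma D_exact (hD : IsKoszulFam 3 4 D) (p : ℕ) (e₀ e₁ e₂ : ℤ) (h1 : e₁ = e₀ + 4) (h2 : e₂ = e₁ + 4)
    (hE : Ex 0 (p + 1) e₁) (z) (hz : DD D p e₁ e₂ z = 0) : ∃ y, DD D (p + 1) e₀ e₁ y = z := by
  have h := dK_Phi hD p e₁ e₂ h2 z
  rw [hz, map_zero, neg_zero] at h
  obtain ⟨w, hw, hdw⟩ := hE _ (Phi_supp _ _ z) h
  have e3 : e₁ - 4 = e₀ := by omega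
  rw [e3] at hw
  obtain ⟨y, rfl⟩ := Phi_surj hw
  rw [dK_Phi hD (p + 1) e₀ e₁ h1] at hdw
  refine ⟨(-1 : ℂ) • y, Phi_inj _ _ ?_⟩
  rw [map_smul, map_smul, neg_one_smul, hdw]

lemma D_exact0 (hD : IsKoszulFam 3 4 D) (e₀ e₁ : ℤ) (h1 : e₁ = e₀ + 4)
    (hE : Ex 0 0 e₁) (z) : ∃ y, DD D 0 e₀ e₁ y = z := by
  have h : dK 0 (Phi 0 e₁ z) = 0 := by
    ext T t
    rw [dK_apply]
    split_ifs
    · refine Finset.sum_eq_zero fun i _ => ?_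
      split_ifs
      · rw [Phi_apply, dif_neg, mul_zero]
        rintro ⟨h, -⟩
        exact Finset.insert_ne_empty _ _ (Finset.card_eq_zero.1 h)
      · rfl
    · rfl
  obtain ⟨w, hw, hdw⟩ := hE _ (Phi_supp _ _ z) h
  have e3 : e₁ - 4 = e₀ := by omega
  rw [e3] at hw
  obtain ⟨y, rfl⟩ := Phi_surj hw
  rw [dK_Phi hD 0 e₀ e₁ h1] at hdw
  refine ⟨(-1 : ℂ) • y, Phi_inj _ _ ?_⟩
  rw [map_smul, map_smul, neg_one_smul, hdw]

lemma D_D (hD : IsKoszulFam 3 4 D) (p : ℕ) (e₀ e₁ e₂ : ℤ) (h1 : e₁ = e₀ + 4) (h2 : e₂ = e₁ + 4)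
    (y) : DD D p e₁ e₂ (DD D (p + 1) e₀ e₁ y) = 0 := by
  apply Phi_inj
  have a := dK_Phi hD p e₁ e₂ h2 (DD D (p + 1) e₀ e₁ y)
  have b := dK_Phi hD (p + 1) e₀ e₁ h1 y
  have c := dK_dK 0 (Phi (p + 1 + 1) e₀ y)
  rw [b, map_neg, a, neg_neg] at c
  rw [c, map_zero]

end VB

set_option maxHeartbeats 400000
open scoped TensorProduct
namespace VB

variable {D : KFam 3 4}

lemma card_Ix (n : ℕ) : Nat.card (Ix (n : ℤ)) = (n + 2).choose 2 := by
  have h : Nat.card (Ix (n : ℤ)) = ((Finset.univ : Finset (Fin 3)).finsuppAntidiag n).card := by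
    rw [← Nat.card_eq_finsetCard]
    refine Nat.card_congr ⟨fun t => ⟨fs t.1, ?_⟩, fun f => ⟨fun i => f.1 i, ?_⟩, ?_, ?_⟩
    · have h := t.2
      rw [Finset.mem_finsuppAntidiag]
      exact ⟨by exact_mod_cast h, Finset.subset_univ _⟩
    · have h := (Finset.mem_finsuppAntidiag.1 f.2).1
      exact_mod_cast h
    · intro t; rfl
    · intro f; apply Subtype.ext; ext i; rfl
  rw [h, Finset.card_finsuppAntidiag_nat_eq_choose]
  simp only [Finset.card_univ, Fintype.card_fin]
  rw [show 3 + n - 1 = n + 2 by omega, Nat.choose_symm_add]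

lemma card_Ix_neg (e : ℤ) (h : e < 0) : Nat.card (Ix e) = 0 := by
  have : IsEmpty (Ix e) := ⟨fun t => by have := t.2; omega⟩
  exact Nat.card_of_isEmpty

instance finKos (p : ℕ) (e : ℤ) : Module.Finite ℂ (KosModule 3 4 p e) :=
  Module.Finite.of_basis (bT p e)

lemma finrank_Kos (p : ℕ) (e : ℤ) :
    Module.finrank ℂ (KosModule 3 4 p e) = Nat.choose 15 p * Nat.card (Ix e) := by
  rw [Module.finrank_eq_nat_card_basis (bT p e), Nat.card_prod, Set.powersetCard.card, Nat.card_fin]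

/-- rank of the differential -/
noncomputable def rk (D : KFam 3 4) (p : ℕ) (q : ℤ) : ℕ :=
  Module.finrank ℂ (LinearMap.range (DD D p (0 + (q - 1) * 4) (0 + q * 4)))

lemma KA (hD : IsKoszulFam 3 4 D) (p : ℕ) (q : ℤ) :
    Kdim 3 4 D 0 (p + 1) q + rk D p (q + 1) + rk D (p + 1) q =
      Nat.choose 15 (p + 1) * Nat.card (Ix (0 + q * 4)) := by
  have hle : LinearMap.range (DD D (p + 1) (0 + (q - 1) * 4) (0 + q * 4)) ≤
      LinearMap.ker (DD D p (0 + q * 4) (0 + (q + 1) * 4)) := by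
    rintro _ ⟨y, rfl⟩
    exact D_D hD p _ _ _ (by ring) (by ring) y
  have hK : Kdim 3 4 D 0 (p + 1) q =
      Module.finrank ℂ (LinearMap.ker (DD D p (0 + q * 4) (0 + (q + 1) * 4))) - rk D (p + 1) q := by
    change Module.finrank ℂ (LinearMap.ker (DD D p (0 + q * 4) (0 + (q + 1) * 4))) -
      Module.finrank ℂ ↥(LinearMap.range (DD D (p + 1) (0 + (q - 1) * 4) (0 + q * 4)) ⊓
      LinearMap.ker (DD D p (0 + q * 4) (0 + (q + 1) * 4))) = _
    rw [inf_eq_left.2 hle]; rfl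
  have h1 := LinearMap.finrank_range_add_finrank_ker (K := ℂ) (V := KosModule 3 4 (p + 1) (0 + q * 4))
    (V₂ := KosModule 3 4 p (0 + (q + 1) * 4)) (DD D p (0 + q * 4) (0 + (q + 1) * 4))
  have hf : Module.Finite ℂ (LinearMap.ker (DD D p (0 + q * 4) (0 + (q + 1) * 4))) :=
    FiniteDimensional.finiteDimensional_submodule (K := ℂ)
      (V := KosModule 3 4 (p + 1) (0 + q * 4)) _
  have h2 : rk D (p + 1) q ≤ _ := Submodule.finrank_mono hle
  have h3 : rk D p (q + 1) =
      Module.finrank ℂ (LinearMap.range (DD D p (0 + q * 4) (0 + (q + 1) * 4))) := by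
    unfold rk; rw [add_sub_cancel_right]
  rw [finrank_Kos] at h1
  omega

lemma K0 (q : ℤ) :
    Kdim 3 4 D 0 0 q + rk D 0 q = Nat.card (Ix (0 + q * 4)) := by
  have hK : Kdim 3 4 D 0 0 q =
      Module.finrank ℂ (KosModule 3 4 0 (0 + q * 4)) - rk D 0 q := rfl
  have h2 : rk D 0 q ≤ Module.finrank ℂ (KosModule 3 4 0 (0 + q * 4)) := Submodule.finrank_le _
  have h := finrank_Kos 0 (0 + q * 4)
  rw [Nat.choose_zero_right, one_mul] at h
  omega

lemma Kz (hD : IsKoszulFam 3 4 D) (p : ℕ) (q : ℤ)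
    (h : q < 0 ∨ (q = 0 ∧ 0 < p) ∨ (q = 1 ∧ 11 ≤ p) ∨ (q = 2 ∧ p ≤ 9) ∨ 3 ≤ q ∨ 13 ≤ p) :
    Kdim 3 4 D 0 p q = 0 := by
  have hE := Ex_all p q h
  rw [show 4 * q = 0 + q * 4 by ring] at hE
  cases p with
  | zero =>
    have hs : LinearMap.range (DD D 0 (0 + (q - 1) * 4) (0 + q * 4)) = ⊤ :=
      LinearMap.range_eq_top.2 fun z => D_exact0 hD _ _ (by ring) hE z
    change Module.finrank ℂ (KosModule 3 4 0 (0 + q * 4)) -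
      Module.finrank ℂ (LinearMap.range (DD D 0 (0 + (q - 1) * 4) (0 + q * 4))) = 0
    rw [hs, finrank_top, Nat.sub_self]
  | succ p =>
    have hle : LinearMap.ker (DD D p (0 + q * 4) (0 + (q + 1) * 4)) ≤
        LinearMap.range (DD D (p + 1) (0 + (q - 1) * 4) (0 + q * 4)) := fun z hz =>
      D_exact hD p _ _ _ (by ring) (by ring) hE z hz
    change Module.finrank ℂ (LinearMap.ker (DD D p (0 + q * 4) (0 + (q + 1) * 4))) -
      Module.finrank ℂ ↥(LinearMap.range (DD D (p + 1) (0 + (q - 1) * 4) (0 + q * 4)) ⊓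
      LinearMap.ker (DD D p (0 + q * 4) (0 + (q + 1) * 4))) = 0
    rw [inf_eq_right.2 hle, Nat.sub_self]

/-- Betti number with natural indices -/
noncomputable def Kn (D : KFam 3 4) (p k : ℕ) : ℕ := Kdim 3 4 D 0 p (k : ℤ)
/-- rank with natural indices -/
noncomputable def Rn (D : KFam 3 4) (p k : ℕ) : ℕ := rk D p (k : ℤ)

lemma card_Ix4 (k : ℕ) : Nat.card (Ix (0 + (k : ℤ) * 4)) = (4 * k + 2).choose 2 := by
  rw [← card_Ix]; congr 2; push_cast; ring

lemma KAn (hD : IsKoszulFam 3 4 D) (p k : ℕ) :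
    Kn D (p + 1) k + Rn D p (k + 1) + Rn D (p + 1) k =
      Nat.choose 15 (p + 1) * (4 * k + 2).choose 2 := by
  have := KA hD p (k : ℤ)
  rw [card_Ix4] at this
  rw [← this]; simp only [Kn, Rn]; push_cast; rfl

lemma K0n (k : ℕ) : Kn D 0 k + Rn D 0 k = (4 * k + 2).choose 2 := by
  rw [← card_Ix4, ← K0 (D := D)]; rfl

lemma R0n (hD : IsKoszulFam 3 4 D) (p : ℕ) : Rn D p 0 = 0 := by
  have h := KA hD p (-1)
  rw [card_Ix_neg _ (by norm_num)] at h
  simp only [Rn]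
  have : ((0 : ℕ) : ℤ) = -1 + 1 := by norm_num
  rw [this]; omega

lemma Kzn (hD : IsKoszulFam 3 4 D) (p k : ℕ)
    (h : (k = 0 ∧ 0 < p) ∨ (k = 1 ∧ 11 ≤ p) ∨ (k = 2 ∧ p ≤ 9) ∨ 3 ≤ k ∨ 13 ≤ p) :
    Kn D p k = 0 := Kz hD p k (by omega)

/-- signed partial sums along a strand -/
def Am (n : ℕ) : ℕ → ℤ
  | 0 => ((4 * n + 2).choose 2 : ℕ)
  | m + 1 => (Nat.choose 15 (m + 1) * (4 * (n - (m + 1)) + 2).choose 2 : ℕ) - Am n m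

lemma strand (hD : IsKoszulFam 3 4 D) (n m : ℕ) (hm : m ≤ n)
    (h : ∀ p ≤ m, Kn D p (n - p) = 0) : (Rn D m (n - m) : ℤ) = Am n m := by
  induction m with
  | zero =>
    have h1 := K0n (D := D) n
    have h2 := h 0 le_rfl
    rw [Nat.sub_zero] at h2 ⊢
    rw [h2, zero_add] at h1
    rw [h1]; rfl
  | succ m ih =>
    have i := ih (by omega) fun p hp => h p (by omega)
    have h1 := KAn hD m (n - (m + 1))
    have h2 := h (m + 1) le_rfl
    rw [show n - (m + 1) + 1 = n - m by omega, h2] at h1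
    simp only [Am]
    rw [← i, ← h1]; push_cast; ring

lemma K1 (hD : IsKoszulFam 3 4 D) (m : ℕ) (hm : m ≤ 9) :
    (Kn D (m + 1) 1 : ℤ) = (Nat.choose 15 (m + 1) * 15 : ℕ) - Nat.choose 15 (m + 2) - Am (m + 2) m := by
  have h := strand hD (m + 2) m (by omega) fun p hp => Kzn hD _ _ (by omega)
  rw [show m + 2 - m = 2 by omega] at h
  have h1 := KAn hD m 1
  have h2 := KAn hD (m + 1) 0
  rw [Kzn hD (m + 1 + 1) 0 (by omega), R0n hD] at h2
  norm_num [Nat.choose_two_right, add_assoc] at h1 h2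
  rw [← h]; push_cast; omega

lemma K2 (hD : IsKoszulFam 3 4 D) (m : ℕ) (hm : 9 ≤ m) :
    (Kn D (m + 1) 2 : ℤ) = (Nat.choose 15 (m + 1) * 45 : ℕ) -
      ((Nat.choose 15 (m + 2) * 15 : ℕ) - Nat.choose 15 (m + 3)) - Am (m + 3) m := by
  have h := strand hD (m + 3) m (by omega) fun p hp => Kzn hD _ _ (by omega)
  rw [show m + 3 - m = 3 by omega] at h
  have h0 := KAn hD m 2
  have h1 := KAn hD (m + 1) 1
  have h2 := KAn hD (m + 1 + 1) 0
  rw [Kzn hD (m + 1 + 1 + 1) 0 (by omega), R0n hD] at h2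
  rw [Kzn hD (m + 1 + 1) 1 (by omega)] at h1
  norm_num [Nat.choose_two_right] at h0 h1 h2
  simp only [add_assoc, Nat.reduceAdd] at h0 h1 h2
  rw [← h]; push_cast; omega

lemma K01 (hD : IsKoszulFam 3 4 D) : Kn D 0 1 = 0 := by
  have h0 := K0n (D := D) 1
  have h1 := KAn hD 0 0
  rw [Kzn hD _ 0 (by omega), R0n hD] at h1
  norm_num [Nat.choose_two_right] at h0 h1
  omega

lemma K00 (hD : IsKoszulFam 3 4 D) : Kn D 0 0 = 1 := by
  have h0 := K0n (D := D) 0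
  rw [R0n hD] at h0
  simpa using h0

theorem main (hD : IsKoszulFam 3 4 D) :
    Kn D 0 0 = 1 ∧ Kn D 1 1 = 75 ∧ Kn D 2 1 = 536 ∧ Kn D 3 1 = 1947 ∧ Kn D 4 1 = 4488 ∧
    Kn D 5 1 = 7095 ∧ Kn D 6 1 = 7920 ∧ Kn D 7 1 = 6237 ∧ Kn D 8 1 = 3344 ∧ Kn D 9 1 = 1089 ∧
    Kn D 10 1 = 120 ∧ Kn D 10 2 = 55 ∧ Kn D 11 2 = 24 ∧ Kn D 12 2 = 3 := by
  refine ⟨K00 hD, ?_, ?_, ?_, ?_, ?_, ?_, ?_, ?_, ?_, ?_, ?_, ?_, ?_⟩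
  · exact Int.ofNat_inj.1 ((K1 hD 0 (by omega)).trans (by decide +kernel))
  · exact Int.ofNat_inj.1 ((K1 hD 1 (by omega)).trans (by decide +kernel))
  · exact Int.ofNat_inj.1 ((K1 hD 2 (by omega)).trans (by decide +kernel))
  · exact Int.ofNat_inj.1 ((K1 hD 3 (by omega)).trans (by decide +kernel))
  · exact Int.ofNat_inj.1 ((K1 hD 4 (by omega)).trans (by decide +kernel))
  · exact Int.ofNat_inj.1 ((K1 hD 5 (by omega)).trans (by decide +kernel))
  · exact Int.ofNat_inj.1 ((K1 hD 6 (by omega)).trans (by decide +kernel))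
  · exact Int.ofNat_inj.1 ((K1 hD 7 (by omega)).trans (by decide +kernel))
  · exact Int.ofNat_inj.1 ((K1 hD 8 (by omega)).trans (by decide +kernel))
  · exact Int.ofNat_inj.1 ((K1 hD 9 (by omega)).trans (by decide +kernel))
  · exact Int.ofNat_inj.1 ((K2 hD 9 (by omega)).trans (by decide +kernel))
  · exact Int.ofNat_inj.1 ((K2 hD 10 (by omega)).trans (by decide +kernel))
  · exact Int.ofNat_inj.1 ((K2 hD 11 (by omega)).trans (by decide +kernel))

theorem mainz (hD : IsKoszulFam 3 4 D) (p : ℕ) (q : ℤ)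
    (h : ¬((p = 0 ∧ q = 0) ∨ (1 ≤ p ∧ p ≤ 10 ∧ q = 1) ∨ (10 ≤ p ∧ p ≤ 12 ∧ q = 2))) :
    Kdim 3 4 D 0 p q = 0 := by
  by_cases h0 : p = 0 ∧ q = 1
  · obtain ⟨rfl, rfl⟩ := h0; exact K01 hD
  · exact Kz hD p q (by omega)

end VB

/-- Betti table of the pushforward of O(b=0) under the 4-uple Veronese embedding of P^2. -/
theorem veronese_betti_P2_b0_d4 (D : KFam 3 4) (hD : IsKoszulFam 3 4 D) :
    Kdim 3 4 D 0 0 0 = 1 ∧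
    Kdim 3 4 D 0 1 1 = 75 ∧
    Kdim 3 4 D 0 2 1 = 536 ∧
    Kdim 3 4 D 0 3 1 = 1947 ∧
    Kdim 3 4 D 0 4 1 = 4488 ∧
    Kdim 3 4 D 0 5 1 = 7095 ∧
    Kdim 3 4 D 0 6 1 = 7920 ∧
    Kdim 3 4 D 0 7 1 = 6237 ∧
    Kdim 3 4 D 0 8 1 = 3344 ∧
    Kdim 3 4 D 0 9 1 = 1089 ∧
    Kdim 3 4 D 0 10 1 = 120 ∧
    Kdim 3 4 D 0 10 2 = 55 ∧
    Kdim 3 4 D 0 11 2 = 24 ∧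
    Kdim 3 4 D 0 12 2 = 3 ∧
    (∀ (p : ℕ) (q : ℤ), ¬((p = 0 ∧ q = 0) ∨ (1 ≤ p ∧ p ≤ 10 ∧ q = 1) ∨ (10 ≤ p ∧ p ≤ 12 ∧ q = 2)) →
      Kdim 3 4 D 0 p q = 0) := by
  obtain ⟨h0, h1, h2, h3, h4, h5, h6, h7, h8, h9, h10, h11, h12, h13⟩ := VB.main hD
  exact ⟨h0, h1, h2, h3, h4, h5, h6, h7, h8, h9, h10, h11, h12, h13,
    fun p q h => VB.mainz hD p q h⟩
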